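/- arXiv:2403.20133 — 6 statements merged into one kernel-verified Lean document; each statement's English description precedes it below -/
import Mathlib

section
/- Let ~ be an indistinguishability relation on Γ*, λ an information-consistent absorbing coloring, and h : Γ* → P a rectangular morphism. Then the set Y* ∩ P of abstract states in the fixpoint, the set P_∀ of universally winning states, and the set P_∃ of existentially winning states all coincide: Y* ∩ P = P_∀ = P_∃. -/
open MeasureTheory
open scoped Classical

section Games

variable {Γ A P : Type}

/-- Histories are finite words over the alphabet of moves. -/
abbrev Hist (Γ : Type) := List Γ

/-- The information set of a history: all histories indistinguishable from it. -/
def InfoSet (sim : Hist Γ → Hist Γ → Prop) (τ : Hist Γ) : Set (Hist Γ) := {τ' | sim τ' τ}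

/-- An indistinguishability relation: an equivalence relation such that related
histories have the same length, the relation is prefix-closed and actions are visible. -/
structure IsIndist (act : Γ → A) (sim : Hist Γ → Hist Γ → Prop) : Prop where
  equiv : Equivalence sim
  length_eq : ∀ τ τ' : Hist Γ, sim τ τ' → τ.length = τ'.length
  prefix_act : ∀ (τ τ' : Hist Γ) (c c' : Γ),
    sim (τ ++ [c]) (τ' ++ [c']) → sim τ τ' ∧ act c = act c'

/-- A function on histories is information consistent if it is constant on information sets. -/
def InfoConsistent {C : Type} (sim : Hist Γ → Hist Γ → Prop) (lam : Hist Γ → C) : Prop :=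
  ∀ τ τ' : Hist Γ, sim τ τ' → lam τ = lam τ'

/-- The coloring is absorbing: once a winning history, always winning. -/
def Absorbing (lam : Hist Γ → Bool) : Prop :=
  ∀ (τ : Hist Γ) (c : Γ), lam τ = true → lam (τ ++ [c]) = true

/-- A rectangular morphism for the game. -/
structure IsRectMorphism (sim : Hist Γ → Hist Γ → Prop) (lam : Hist Γ → Bool)
    (h : Hist Γ → P) : Prop where
  surj : Function.Surjective h
  rect : ∀ τ τ' : Hist Γ, h τ = h τ' → h '' InfoSet sim τ = h '' InfoSet sim τ'
  morph : ∀ (τ τ' : Hist Γ) (c : Γ), h τ = h τ' → h (τ ++ [c]) = h (τ' ++ [c])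
  refines : ∀ τ τ' : Hist Γ, h τ = h τ' → lam τ = lam τ'

/-- The relation ≈ on abstract states: ≈ = {(h τ, h τ') | τ ~ τ'}. -/
def approx (sim : Hist Γ → Hist Γ → Prop) (h : Hist Γ → P) (p p' : P) : Prop :=
  ∃ τ τ' : Hist Γ, sim τ τ' ∧ h τ = p ∧ h τ' = p'

/-- The extension of ≈ to P ⊕ (P × A). -/
def approxS (sim : Hist Γ → Hist Γ → Prop) (h : Hist Γ → P) :
    (P ⊕ P × A) → (P ⊕ P × A) → Prop
  | Sum.inl p, Sum.inl p' => approx sim h p p'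
  | Sum.inr (p, a), Sum.inr (p', a') => approx sim h p p' ∧ a = a'
  | _, _ => False

/-- The intr of a set under an equivalence relation. -/
def intr {S : Type} (r : S → S → Prop) (T : Set S) : Set S :=
  {t | ∀ t', r t' t → t' ∈ T}

/-- The set P_F of target (final) abstract states. -/
def targetSet (lam : Hist Γ → Bool) (h : Hist Γ → P) : Set P :=
  {p | ∃ τ : Hist Γ, h τ = p ∧ lam τ = true}

/-- The set P_F viewed inside P ⊕ (P × A). -/
def targetS (A : Type) (lam : Hist Γ → Bool) (h : Hist Γ → P) : Set (P ⊕ P × A) :=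
  Sum.inl '' targetSet lam h

/-- Membership in the predecessor operator. -/
def PreMem (act : Γ → A) (δP : P → Γ → P) (X : Set (P ⊕ P × A)) : (P ⊕ P × A) → Prop
  | Sum.inl p => ∃ a : A, Sum.inr (p, a) ∈ X
  | Sum.inr (p, a) => ∀ c : Γ, act c = a → Sum.inl (δP p c) ∈ X

/-- The predecessor operator Pre on subsets of P ⊕ (P × A). -/
def Pre (act : Γ → A) (δP : P → Γ → P) (X : Set (P ⊕ P × A)) : Set (P ⊕ P × A) :=
  {s | PreMem act δP X s}

lemma Pre_mono (act : Γ → A) (δP : P → Γ → P) : Monotone (Pre act δP) := by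
  intro X Y hXY s hs
  cases s with
  | inl p =>
      obtain ⟨a, ha⟩ := hs
      exact ⟨a, hXY ha⟩
  | inr pa =>
      obtain ⟨p, a⟩ := pa
      exact fun c hc => hXY (hs c hc)

/-- The inner (monotone) operator X ↦ int≈(Y) ∩ (Pre(X) ∪ P_F). -/
def innerOp (sim : Hist Γ → Hist Γ → Prop) (h : Hist Γ → P) (act : Γ → A)
    (δP : P → Γ → P) (lam : Hist Γ → Bool) (Y : Set (P ⊕ P × A)) :
    Set (P ⊕ P × A) →o Set (P ⊕ P × A) :=
  ⟨fun X => intr (approxS sim h) Y ∩ (Pre act δP X ∪ targetS A lam h),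
   fun _ _ hXX' =>
     Set.inter_subset_inter le_rfl (Set.union_subset_union (Pre_mono act δP hXX') le_rfl)⟩

/-- The outer (monotone) operator Y ↦ μX. int≈(Y) ∩ (Pre(X) ∪ P_F). -/
def outerOp (sim : Hist Γ → Hist Γ → Prop) (h : Hist Γ → P) (act : Γ → A)
    (δP : P → Γ → P) (lam : Hist Γ → Bool) :
    Set (P ⊕ P × A) →o Set (P ⊕ P × A) :=
  ⟨fun Y => OrderHom.lfp (innerOp sim h act δP lam Y),
   by
     intro Y Y' hYY'
     exact OrderHom.lfp.monotone fun X =>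
       Set.inter_subset_inter (fun t ht t' hr => hYY' (ht t' hr)) le_rfl⟩

/-- The fixpoint Y* = νY. μX. int≈(Y) ∩ (Pre(X) ∪ P_F). -/
def Ystar (sim : Hist Γ → Hist Γ → Prop) (h : Hist Γ → P) (act : Γ → A)
    (δP : P → Γ → P) (lam : Hist Γ → Bool) : Set (P ⊕ P × A) :=
  OrderHom.gfp (outerOp sim h act δP lam)

/-- A probability distribution on a finite type. -/
structure PDist (X : Type) [Fintype X] where
  f : X → ℝ
  nonneg : ∀ x, 0 ≤ f x
  sum_one : ∑ x, f x = 1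

variable [Fintype Γ] [Fintype A]

/-- A strategy of the player is information consistent. -/
def IsPlayerStrat (sim : Hist Γ → Hist Γ → Prop) (α : Hist Γ → PDist A) : Prop :=
  ∀ τ τ' : Hist Γ, sim τ τ' → α τ = α τ'

/-- A strategy of the environment only plays moves supported by the given action. -/
def IsEnvStrat (act : Γ → A) (β : Hist Γ → A → PDist Γ) : Prop :=
  ∀ (τ : Hist Γ) (a : A) (c : Γ), 0 < (β τ a).f c → act c = a

/-- Plays are infinite sequences of moves. -/
abbrev Play (Γ : Type) := ℕ → Γ

/-- The cylinder set spanned by a finite history. -/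
def Cyl (ρ : List Γ) : Set (Play Γ) := {π | ∀ i : Fin ρ.length, π i.1 = ρ.get i}

/-- The σ-algebra on plays generated by cylinder sets. -/
instance playMS : MeasurableSpace (Play Γ) :=
  .generateFrom {s | ∃ ρ : List Γ, s = Cyl ρ}

/-- The probability that the game, started after history τ, follows a given
further sequence of moves, under strategies α and β. -/
noncomputable def extProb (act : Γ → A) (α : Hist Γ → PDist A) (β : Hist Γ → A → PDist Γ) :
    Hist Γ → List Γ → ℝ
  | _, [] => 1
  | τ, c :: l => (α τ).f (act c) * (β τ (act c)).f c * extProb act α β (τ ++ [c]) l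

/-- μ is the probability measure Pr_τ^{α,β}: its value on every cylinder set is prescribed. -/
def IsPrMeasure (act : Γ → A) (α : Hist Γ → PDist A) (β : Hist Γ → A → PDist Γ)
    (τ : Hist Γ) (μ : Measure (Play Γ)) : Prop :=
  IsProbabilityMeasure μ ∧
  ∀ ρ : Hist Γ, μ (Cyl ρ) =
    if ρ <+: τ then 1
    else if τ <+: ρ then ENNReal.ofReal (extProb act α β τ (ρ.drop τ.length))
    else 0

/-- The reachability event: the set of plays having a finite prefix of color 1. -/
def ReachEvent (lam : Hist Γ → Bool) : Set (Play Γ) :=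
  {π | ∃ n : ℕ, lam (List.ofFn fun i : Fin n => π i.1) = true}

/-- The strategy α is almost-sure winning from the information set [τ]~ for reachability. -/
def ASWinFrom (act : Γ → A) (sim : Hist Γ → Hist Γ → Prop) (lam : Hist Γ → Bool)
    (α : Hist Γ → PDist A) (τ : Hist Γ) : Prop :=
  ∀ τ' : Hist Γ, τ' ∈ InfoSet sim τ →
    ∀ β : Hist Γ → A → PDist Γ, IsEnvStrat act β →
      ∀ μ : Measure (Play Γ), IsPrMeasure act α β τ' μ → μ (ReachEvent lam) = 1

/-- The set P_∃ of existentially winning abstract states. -/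
def Pexists (act : Γ → A) (sim : Hist Γ → Hist Γ → Prop) (lam : Hist Γ → Bool)
    (h : Hist Γ → P) : Set P :=
  {p | ∃ τ : Hist Γ, h τ = p ∧
    ∃ α : Hist Γ → PDist A, IsPlayerStrat sim α ∧ ASWinFrom act sim lam α τ}

/-- The set P_∀ of universally winning abstract states. -/
def Pforall (act : Γ → A) (sim : Hist Γ → Hist Γ → Prop) (lam : Hist Γ → Bool)
    (h : Hist Γ → P) : Set P :=
  {p | ∀ τ : Hist Γ, h τ = p →
    ∃ α : Hist Γ → PDist A, IsPlayerStrat sim α ∧ ASWinFrom act sim lam α τ}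

end Games


section Helpers

set_option linter.unusedSectionVars false

variable {Γ A P : Type} [Fintype Γ] [Fintype A]

/-- One-step weight. -/
noncomputable def wt (act : Γ → A) (α : Hist Γ → PDist A) (β : Hist Γ → A → PDist Γ)
    (τ : Hist Γ) (c : Γ) : ℝ := (α τ).f (act c) * (β τ (act c)).f c

lemma wt_nonneg (act : Γ → A) (α : Hist Γ → PDist A) (β : Hist Γ → A → PDist Γ)
    (τ : Hist Γ) (c : Γ) : 0 ≤ wt act α β τ c :=
  mul_nonneg ((α τ).nonneg _) ((β τ _).nonneg _)

lemma env_zero {act : Γ → A} {β : Hist Γ → A → PDist Γ} (hβ : IsEnvStrat act β)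
    (τ : Hist Γ) (a : A) (c : Γ) (hc : act c ≠ a) : (β τ a).f c = 0 := by
  by_contra hne
  exact hc (hβ τ a c (lt_of_le_of_ne ((β τ a).nonneg c) (Ne.symm hne)))

lemma wt_sum {act : Γ → A} (α : Hist Γ → PDist A) {β : Hist Γ → A → PDist Γ}
    (hβ : IsEnvStrat act β) (τ : Hist Γ) : ∑ c, wt act α β τ c = 1 := by
  have h1 : ∀ c, wt act α β τ c = ∑ a, (α τ).f a * (β τ a).f c := by
    intro c
    rw [Finset.sum_eq_single (act c)]
    · rfl
    · intro a _ ha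
      rw [env_zero hβ τ a c (Ne.symm ha), mul_zero]
    · simp
  simp_rw [h1]
  rw [Finset.sum_comm]
  simp_rw [← Finset.mul_sum, (β τ _).sum_one, mul_one]
  exact (α τ).sum_one

/-- Probability of not having reached the target after k steps. -/
noncomputable def qq (act : Γ → A) (lam : Hist Γ → Bool) (α : Hist Γ → PDist A)
    (β : Hist Γ → A → PDist Γ) : ℕ → Hist Γ → ℝ
  | 0, τ => if lam τ = true then 0 else 1
  | k + 1, τ => ∑ c, wt act α β τ c * qq act lam α β k (τ ++ [c])

lemma qq_nonneg (act : Γ → A) (lam : Hist Γ → Bool) (α : Hist Γ → PDist A)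
    (β : Hist Γ → A → PDist Γ) (k : ℕ) (τ : Hist Γ) : 0 ≤ qq act lam α β k τ := by
  induction k generalizing τ with
  | zero => unfold qq; split_ifs <;> norm_num
  | succ k ih =>
    unfold qq
    exact Finset.sum_nonneg fun c _ => mul_nonneg (wt_nonneg ..) (ih _)

lemma qq_le_one {act : Γ → A} (lam : Hist Γ → Bool) (α : Hist Γ → PDist A)
    {β : Hist Γ → A → PDist Γ} (hβ : IsEnvStrat act β) (k : ℕ) (τ : Hist Γ) :
    qq act lam α β k τ ≤ 1 := by
  induction k generalizing τ with
  | zero => unfold qq; split_ifs <;> norm_num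
  | succ k ih =>
    unfold qq
    rw [← wt_sum α hβ τ]
    exact Finset.sum_le_sum fun c _ => mul_le_of_le_one_right (wt_nonneg ..) (ih _)

lemma qq_zero_of_lam (act : Γ → A) {lam : Hist Γ → Bool} (habs : Absorbing lam)
    (α : Hist Γ → PDist A) (β : Hist Γ → A → PDist Γ) (k : ℕ) (τ : Hist Γ)
    (hl : lam τ = true) : qq act lam α β k τ = 0 := by
  induction k generalizing τ with
  | zero => simp [qq, hl]
  | succ k ih =>
    unfold qq
    exact Finset.sum_eq_zero fun c _ => by rw [ih _ (habs τ c hl), mul_zero]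

lemma qq_succ_le {act : Γ → A} {lam : Hist Γ → Bool} (habs : Absorbing lam)
    (α : Hist Γ → PDist A) {β : Hist Γ → A → PDist Γ} (hβ : IsEnvStrat act β)
    (k : ℕ) (τ : Hist Γ) : qq act lam α β (k + 1) τ ≤ qq act lam α β k τ := by
  induction k generalizing τ with
  | zero =>
    by_cases hl : lam τ = true
    · rw [qq_zero_of_lam act habs α β _ τ hl]; exact qq_nonneg ..
    · refine (qq_le_one lam α hβ _ τ).trans ?_
      simp [qq, hl]
  | succ k ih =>
    rw [qq.eq_2, qq.eq_2 (k := k)]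
    exact Finset.sum_le_sum fun c _ => mul_le_mul_of_nonneg_left (ih _) (wt_nonneg ..)

lemma qq_anti {act : Γ → A} {lam : Hist Γ → Bool} (habs : Absorbing lam)
    (α : Hist Γ → PDist A) {β : Hist Γ → A → PDist Γ} (hβ : IsEnvStrat act β)
    (τ : Hist Γ) : Antitone (fun k => qq act lam α β k τ) :=
  antitone_nat_of_succ_le fun k => qq_succ_le habs α hβ k τ

lemma extProb_append (act : Γ → A) (α : Hist Γ → PDist A) (β : Hist Γ → A → PDist Γ)
    (τ : Hist Γ) (l : List Γ) (c : Γ) :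
    extProb act α β τ (l ++ [c]) = extProb act α β τ l * wt act α β (τ ++ l) c := by
  induction l generalizing τ with
  | nil => simp [extProb, wt]
  | cons d l ih =>
    simp only [List.cons_append, extProb]
    rw [ih]
    simp [mul_assoc]

lemma extProb_nonneg (act : Γ → A) (α : Hist Γ → PDist A) (β : Hist Γ → A → PDist Γ)
    (τ : Hist Γ) (l : List Γ) : 0 ≤ extProb act α β τ l := by
  induction l generalizing τ with
  | nil => simp [extProb]
  | cons d l ih =>
    simp only [extProb]
    exact mul_nonneg (wt_nonneg act α β τ d) (ih _)

/-- Prefix of length n of a play. -/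
def pre (π : Play Γ) (n : ℕ) : Hist Γ := List.ofFn fun i : Fin n => π i.1


lemma pre_length (π : Play Γ) (n : ℕ) : (pre π n).length = n := by simp [pre]

lemma pre_succ (π : Play Γ) (n : ℕ) : pre π (n + 1) = pre π n ++ [π n] := by
  unfold pre
  rw [List.ofFn_succ_last]
  simp

lemma mem_Cyl (π : Play Γ) (ρ : Hist Γ) : π ∈ Cyl ρ ↔ pre π ρ.length = ρ := by
  constructor
  · intro hπ
    apply List.ext_get
    · simp [pre]
    · intro n h1 h2
      simpa [pre] using hπ ⟨n, h2⟩
  · intro hπ i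
    have : π i.1 = (pre π ρ.length).get ⟨i.1, by simp [pre]⟩ := by simp [pre]
    rw [this]
    simp [hπ]

lemma measurable_Cyl (ρ : Hist Γ) : MeasurableSet (Cyl ρ) :=
  MeasurableSpace.measurableSet_generateFrom ⟨ρ, rfl⟩

/-- Plays not having reached the target at time n. -/
def UU (lam : Hist Γ → Bool) (n : ℕ) : Set (Play Γ) := {π | ¬ lam (pre π n) = true}

lemma measurable_UU (lam : Hist Γ → Bool) (n : ℕ) : MeasurableSet (UU lam n) := by
  have : UU lam n = ⋃ ρ ∈ {ρ : Hist Γ | ρ.length = n ∧ ¬ lam ρ = true}, Cyl ρ := by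
    ext π
    simp only [UU, Set.mem_ofPred_eq, Set.mem_iUnion, mem_Cyl, exists_prop]
    constructor
    · intro hh
      exact ⟨pre π n, ⟨pre_length π n, hh⟩, by rw [pre_length]⟩
    · rintro ⟨ρ, ⟨rfl, h2⟩, h3⟩
      rwa [h3]
  rw [this]
  exact MeasurableSet.biUnion (Set.to_countable _) fun ρ _ => measurable_Cyl ρ

lemma Cyl_split (ρ : Hist Γ) : Cyl ρ = ⋃ c : Γ, Cyl (ρ ++ [c]) := by
  ext π
  simp only [Set.mem_iUnion, mem_Cyl, List.length_append, List.length_singleton, pre_succ]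
  constructor
  · intro hh
    exact ⟨π ρ.length, by rw [hh]⟩
  · rintro ⟨c, hc⟩
    exact (List.append_inj' hc rfl).1

lemma Cyl_disj (ρ : Hist Γ) : Pairwise (Function.onFun Disjoint fun c : Γ => Cyl (ρ ++ [c])) := by
  intro c d hcd
  rw [Function.onFun, Set.disjoint_left]
  intro π h1 h2
  simp only [mem_Cyl, List.length_append, List.length_singleton, pre_succ] at h1 h2
  have := h1.symm.trans h2
  simp at this
  exact hcd this

lemma meas_ext {act : Γ → A} {α : Hist Γ → PDist A} {β : Hist Γ → A → PDist Γ}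
    {τ : Hist Γ} {μ : Measure (Play Γ)} (hμ : IsPrMeasure act α β τ μ) (l : List Γ) :
    μ (Cyl (τ ++ l)) = ENNReal.ofReal (extProb act α β τ l) := by
  rw [hμ.2]
  split_ifs with h1 h2
  · have : l = [] := by
      have := h1.length_le
      simp at this
      exact this
    subst this
    simp [extProb]
  · simp
  · exact absurd (List.prefix_append τ l) h2

lemma meas_UU {act : Γ → A} {lam : Hist Γ → Bool} {α : Hist Γ → PDist A}
    {β : Hist Γ → A → PDist Γ}
    {τ : Hist Γ} {μ : Measure (Play Γ)} (hμ : IsPrMeasure act α β τ μ) (k : ℕ) (l : List Γ) :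
    μ (Cyl (τ ++ l) ∩ UU lam ((τ ++ l).length + k)) =
      μ (Cyl (τ ++ l)) * ENNReal.ofReal (qq act lam α β k (τ ++ l)) := by
  induction k generalizing l with
  | zero =>
    by_cases hl : lam (τ ++ l) = true
    · have : Cyl (τ ++ l) ∩ UU lam ((τ ++ l).length + 0) = ∅ := by
        ext π
        simp only [Set.mem_inter_iff, mem_Cyl, UU, Set.mem_ofPred_eq, add_zero,
          Set.mem_empty_iff_false, iff_false, not_and, not_not]
        intro h1; rw [h1]; exact hl
      rw [this]; simp [qq, hl]
    · have : Cyl (τ ++ l) ∩ UU lam ((τ ++ l).length + 0) = Cyl (τ ++ l) := by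
        ext π
        simp only [Set.mem_inter_iff, mem_Cyl, UU, Set.mem_ofPred_eq, add_zero,
          and_iff_left_iff_imp]
        intro h1; rw [h1]; exact hl
      rw [this]; simp [qq, hl]
  | succ k ih =>
    have h1 : Cyl (τ ++ l) ∩ UU lam ((τ ++ l).length + (k + 1)) =
        ⋃ c : Γ, (Cyl (τ ++ (l ++ [c])) ∩ UU lam ((τ ++ (l ++ [c])).length + k)) := by
      have h2 : ∀ c : Γ, (τ ++ (l ++ [c])).length + k = (τ ++ l).length + (k + 1) := by
        intro c; simp; omega
      simp_rw [h2]
      rw [Cyl_split, Set.iUnion_inter]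
      simp only [List.append_assoc]
    rw [h1, measure_iUnion, tsum_fintype]
    · simp_rw [ih]
      simp_rw [meas_ext hμ, extProb_append]
      rw [qq, ← ENNReal.ofReal_mul (extProb_nonneg ..), Finset.mul_sum,
        ENNReal.ofReal_sum_of_nonneg]
      · refine Finset.sum_congr rfl fun c _ => ?_
        rw [← ENNReal.ofReal_mul (mul_nonneg (extProb_nonneg ..) (wt_nonneg ..)), mul_assoc,
          List.append_assoc]
      · intro c _
        exact mul_nonneg (extProb_nonneg ..) (mul_nonneg (wt_nonneg ..) (qq_nonneg ..))
    · intro c d hcd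
      have := Cyl_disj (τ ++ l) hcd
      simp only [Function.onFun, List.append_assoc] at this ⊢
      exact this.mono Set.inter_subset_left Set.inter_subset_left
    · intro c
      exact (measurable_Cyl _).inter (measurable_UU _ _)

lemma UU_anti {lam : Hist Γ → Bool} (habs : Absorbing lam) : Antitone (UU lam) := by
  refine antitone_nat_of_succ_le fun n π hπ hl => hπ ?_
  rw [pre_succ]
  exact habs _ _ hl

lemma reach_compl (lam : Hist Γ → Bool) : (ReachEvent lam)ᶜ = ⋂ n, UU lam n := by
  ext π
  simp [ReachEvent, UU, pre]

lemma measurable_reach (lam : Hist Γ → Bool) : MeasurableSet (ReachEvent lam) := by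
  rw [← MeasurableSet.compl_iff, reach_compl]
  exact MeasurableSet.iInter fun n => measurable_UU lam n

lemma reach_iff {act : Γ → A} {lam : Hist Γ → Bool} (habs : Absorbing lam) {α : Hist Γ → PDist A}
    {β : Hist Γ → A → PDist Γ}
    {τ : Hist Γ} {μ : Measure (Play Γ)} (hμ : IsPrMeasure act α β τ μ) :
    μ (ReachEvent lam) = 1 ↔
      Filter.Tendsto (fun k => qq act lam α β k τ) Filter.atTop (nhds 0) := by
  have := hμ.1
  have hU : ∀ k, μ (UU lam (τ.length + k)) = ENNReal.ofReal (qq act lam α β k τ) := by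
    intro k
    have h1 := meas_UU (lam := lam) hμ k []
    have h2 := meas_ext hμ []
    simp only [List.append_nil, extProb, ENNReal.ofReal_one] at h1 h2
    rw [h2, one_mul] at h1
    rw [← h1, Set.inter_comm]
    refine (measure_inter_conull ?_).symm
    exact (prob_compl_eq_zero_iff (measurable_Cyl τ)).2 h2
  have hT : Filter.Tendsto (fun n => μ (UU lam n)) Filter.atTop
      (nhds (μ (ReachEvent lam)ᶜ)) := by
    rw [reach_compl]
    exact tendsto_measure_iInter_atTop (fun n => (measurable_UU lam n).nullMeasurableSet)
      (UU_anti habs) ⟨0, measure_ne_top _ _⟩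
  have hT2 : Filter.Tendsto (fun k => ENNReal.ofReal (qq act lam α β k τ)) Filter.atTop
      (nhds (μ (ReachEvent lam)ᶜ)) := by
    have := (hT.comp (Filter.tendsto_add_atTop_nat τ.length))
    refine this.congr fun k => ?_
    simp only [Function.comp]
    rw [add_comm, hU]
  rw [← prob_compl_eq_zero_iff (measurable_reach lam)]
  constructor
  · intro h0
    rw [h0] at hT2
    have := (ENNReal.tendsto_toReal ENNReal.zero_ne_top).comp hT2
    refine this.congr fun k => ?_
    simp [ENNReal.toReal_ofReal (qq_nonneg ..)]
  · intro h0
    have := ENNReal.tendsto_ofReal h0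
    rw [ENNReal.ofReal_zero] at this
    exact tendsto_nhds_unique hT2 this

/-- History obtained from a choice function after n steps. -/
def HH (τ : Hist Γ) (f : Hist Γ → Γ) : ℕ → Hist Γ
  | 0 => τ
  | n + 1 => HH τ f n ++ [f (HH τ f n)]

lemma HH_length (τ : Hist Γ) (f : Hist Γ → Γ) (n : ℕ) : (HH τ f n).length = τ.length + n := by
  induction n with
  | zero => rfl
  | succ n ih => simp [HH, ih, add_assoc]

lemma HH_prefix (τ : Hist Γ) (f : Hist Γ → Γ) {m n : ℕ} (hmn : m ≤ n) :
    HH τ f m <+: HH τ f n := by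
  induction n, hmn using Nat.le_induction with
  | base => exact List.prefix_rfl
  | succ n _ ih => exact ih.trans (List.prefix_append _ _)

/-- The play generated by a choice function. -/
def playOf (τ : Hist Γ) (f : Hist Γ → Γ) : Play Γ :=
  fun i => (HH τ f (i + 1)).get ⟨i, by rw [HH_length]; omega⟩

lemma pre_playOf (τ : Hist Γ) (f : Hist Γ → Γ) (n : ℕ) :
    pre (playOf τ f) (τ.length + n) = HH τ f n := by
  apply List.ext_get
  · simp [pre, HH_length]
  · intro i h1 h2
    have h3 : i < (HH τ f (i + 1)).length := by rw [HH_length]; omega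
    have : (HH τ f (i + 1))[i]'h3 = (HH τ f n)[i]'h2 := by
      rcases le_total (i + 1) n with hle | hle
      · exact List.IsPrefix.getElem (HH_prefix τ f hle) h3
      · exact (List.IsPrefix.getElem (HH_prefix τ f hle) h2).symm
    simpa [pre, playOf] using this

lemma pre_prefix (π : Play Γ) {m n : ℕ} (hmn : m ≤ n) : pre π m <+: pre π n := by
  induction n, hmn using Nat.le_induction with
  | base => exact List.prefix_rfl
  | succ n _ ih => rw [pre_succ]; exact ih.trans (List.prefix_append _ _)

lemma box_exists (act : Γ → A) (α : Hist Γ → PDist A) (β : Hist Γ → A → PDist Γ)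
    (τ : Hist Γ) (l : List Γ) :
    ∃ (S : Finset (Hist Γ)) (t : Hist Γ → Γ), (∀ σ ∈ S, σ.length < τ.length + l.length) ∧
      {f | playOf τ f ∈ Cyl (τ ++ l)} = Set.pi S (fun σ => {t σ}) ∧
      ∏ σ ∈ S, ENNReal.ofReal (wt act α β σ (t σ)) = ENNReal.ofReal (extProb act α β τ l) := by
  have hset : ∀ l : List Γ, {f | playOf τ f ∈ Cyl (τ ++ l)} = {f | HH τ f l.length = τ ++ l} := by
    intro l
    ext f
    simp [mem_Cyl, pre_playOf]
  rw [hset]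
  induction l using List.reverseRecOn with
  | nil =>
    by_cases hne : Nonempty (Hist Γ → Γ)
    · obtain ⟨t⟩ := hne
      refine ⟨∅, t, by simp, ?_, by simp [extProb]⟩
      ext f; simp [HH]
    · have hG : IsEmpty Γ := by
        by_contra hG
        rw [not_isEmpty_iff] at hG
        exact hne inferInstance
      exfalso
      have h1 := (α τ).sum_one
      have : Nonempty A := by
        by_contra hA
        rw [not_nonempty_iff] at hA
        simp at h1
      obtain ⟨a⟩ := this
      have h2 := (β τ a).sum_one
      simp at h2
  | append_singleton l c ih =>
    obtain ⟨S, t, h1, h2, h3⟩ := ih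
    have hnot : τ ++ l ∉ S := by
      intro hm
      have := h1 _ hm
      simp at this
    refine ⟨insert (τ ++ l) S, Function.update t (τ ++ l) c, ?_, ?_, ?_⟩
    · intro σ hσ
      rcases Finset.mem_insert.1 hσ with rfl | hσ
      · simp
      · have := h1 σ hσ
        simp; omega
    · have h4 : {f | HH τ f (l ++ [c]).length = τ ++ (l ++ [c])} =
          {f | HH τ f l.length = τ ++ l} ∩ {f | f (τ ++ l) = c} := by
        ext f
        simp only [List.length_append, List.length_singleton, HH, Set.mem_ofPred_eq,
          Set.mem_inter_iff, ← List.append_assoc]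
        constructor
        · intro hf
          have := List.append_inj' hf rfl
          refine ⟨this.1, ?_⟩
          have h5 := this.2
          rw [this.1] at h5
          simpa using h5
        · rintro ⟨h5, h6⟩
          rw [h5, h6]
      rw [h4, h2]
      ext f
      simp only [Set.mem_inter_iff, Set.mem_pi, Finset.mem_coe, Set.mem_singleton_iff,
        Set.mem_ofPred_eq, Finset.mem_insert]
      constructor
      · rintro ⟨h5, h6⟩ σ (rfl | hσ)
        · simpa using h6
        · rw [Function.update_of_ne (fun he : σ = τ ++ l => hnot (by rw [← he]; exact hσ))]
          exact h5 σ hσ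
      · intro h5
        refine ⟨fun σ hσ => ?_, ?_⟩
        · have := h5 σ (Or.inr hσ)
          rwa [Function.update_of_ne (fun he : σ = τ ++ l => hnot (by rw [← he]; exact hσ))] at this
        · simpa using h5 _ (Or.inl rfl)
    · rw [Finset.prod_insert hnot, extProb_append, ENNReal.ofReal_mul (extProb_nonneg ..), ← h3,
        mul_comm, Function.update_self]
      congr 1
      refine Finset.prod_congr rfl fun σ hσ => ?_
      rw [Function.update_of_ne (fun he : σ = τ ++ l => hnot (by rw [← he]; exact hσ))]

lemma exists_measure {act : Γ → A} (α : Hist Γ → PDist A) {β : Hist Γ → A → PDist Γ}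
    (hβ : IsEnvStrat act β) (τ : Hist Γ) : ∃ μ, IsPrMeasure act α β τ μ := by
  letI : MeasurableSpace Γ := ⊤
  haveI : MeasurableSingletonClass Γ := ⟨fun _ => trivial⟩
  let p : Hist Γ → PMF Γ := fun σ => PMF.ofFintype (fun c => ENNReal.ofReal (wt act α β σ c)) (by
    rw [← ENNReal.ofReal_sum_of_nonneg (fun c _ => wt_nonneg ..), wt_sum α hβ,
      ENNReal.ofReal_one])
  let ν : Measure (Hist Γ → Γ) := Measure.infinitePi fun σ => (p σ).toMeasure
  have hν : IsProbabilityMeasure ν := inferInstance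
  have hbox : ∀ l : List Γ, MeasurableSet {f | playOf τ f ∈ Cyl (τ ++ l)} ∧
      ν {f | playOf τ f ∈ Cyl (τ ++ l)} = ENNReal.ofReal (extProb act α β τ l) := by
    intro l
    obtain ⟨S, t, -, h2, h3⟩ := box_exists act α β τ l
    rw [h2]
    refine ⟨MeasurableSet.pi S.countable_toSet fun _ _ => measurableSet_singleton _, ?_⟩
    rw [Measure.infinitePi_pi _ fun _ _ => measurableSet_singleton _, ← h3]
    refine Finset.prod_congr rfl fun σ _ => ?_
    rw [PMF.toMeasure_apply_singleton _ _ (measurableSet_singleton _)]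
    rfl
  have hpre : ∀ ρ : Hist Γ, ρ <+: τ → {f | playOf τ f ∈ Cyl ρ} = Set.univ := by
    intro ρ hρ
    ext f
    simp only [Set.mem_ofPred_eq, Set.mem_univ, iff_true, mem_Cyl]
    have h1 := pre_prefix (playOf τ f) hρ.length_le
    have h2 := pre_playOf τ f 0
    simp only [add_zero, HH] at h2
    rw [h2] at h1
    exact (List.prefix_of_prefix_length_le h1 hρ (by simp [pre_length])).eq_of_length
      (pre_length _ _)
  have hno : ∀ ρ : Hist Γ, ¬ ρ <+: τ → ¬ τ <+: ρ → {f | playOf τ f ∈ Cyl ρ} = ∅ := by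
    intro ρ h1 h2
    ext f
    simp only [Set.mem_ofPred_eq, Set.mem_empty_iff_false, iff_false, mem_Cyl]
    intro h3
    have h4 := pre_playOf τ f 0
    simp only [add_zero, HH] at h4
    rcases le_total ρ.length τ.length with hle | hle
    · apply h1
      have := pre_prefix (playOf τ f) hle
      rwa [h3, h4] at this
    · apply h2
      have := pre_prefix (playOf τ f) hle
      rwa [h3, h4] at this
  have hmeas : Measurable (playOf τ : (Hist Γ → Γ) → Play Γ) := by
    refine measurable_generateFrom ?_
    rintro _ ⟨ρ, rfl⟩
    change MeasurableSet {f | playOf τ f ∈ Cyl ρ}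
    by_cases h1 : ρ <+: τ
    · rw [hpre ρ h1]; exact MeasurableSet.univ
    · by_cases h2 : τ <+: ρ
      · obtain ⟨l, rfl⟩ := h2
        exact (hbox l).1
      · rw [hno ρ h1 h2]; exact MeasurableSet.empty
  refine ⟨ν.map (playOf τ), Measure.isProbabilityMeasure_map hmeas.aemeasurable, fun ρ => ?_⟩
  rw [Measure.map_apply hmeas (measurable_Cyl ρ)]
  change ν {f | playOf τ f ∈ Cyl ρ} = _
  split_ifs with h1 h2
  · rw [hpre ρ h1]; exact measure_univ
  · obtain ⟨l, rfl⟩ := h2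
    rw [(hbox l).2]; simp
  · rw [hno ρ h1 h2]; simp

/-- Combinatorial form of winning. -/
def Wn (act : Γ → A) (sim : Hist Γ → Hist Γ → Prop) (lam : Hist Γ → Bool)
    (α : Hist Γ → PDist A) (τ : Hist Γ) : Prop :=
  ∀ τ' : Hist Γ, sim τ' τ → ∀ β : Hist Γ → A → PDist Γ, IsEnvStrat act β →
    Filter.Tendsto (fun k => qq act lam α β k τ') Filter.atTop (nhds 0)

lemma win_iff {act : Γ → A} {sim : Hist Γ → Hist Γ → Prop} {lam : Hist Γ → Bool}
    (habs : Absorbing lam) (α : Hist Γ → PDist A) (τ : Hist Γ) :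
    ASWinFrom act sim lam α τ ↔ Wn act sim lam α τ := by
  constructor
  · intro hw τ' hτ' β hβ
    obtain ⟨μ, hμ⟩ := exists_measure α hβ τ'
    exact (reach_iff habs hμ).1 (hw τ' hτ' β hβ μ hμ)
  · intro hw τ' hτ' β hβ μ hμ
    exact (reach_iff habs hμ).2 (hw τ' hτ' β hβ)

/-- Dirac distribution. -/
noncomputable def dirac' (c : Γ) : PDist Γ where
  f := fun d => if d = c then 1 else 0
  nonneg := fun d => by split_ifs <;> norm_num
  sum_one := by simp

lemma dirac'_pos {c d : Γ} (hd : 0 < (dirac' c).f d) : d = c := by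
  by_contra hne
  simp [dirac', hne] at hd

lemma qq_congr (act : Γ → A) (lam : Hist Γ → Bool) (α : Hist Γ → PDist A)
    (β β' : Hist Γ → A → PDist Γ) (n : ℕ) (hb : ∀ σ : Hist Γ, n ≤ σ.length → β σ = β' σ)
    (k : ℕ) (τ : Hist Γ) (hτ : n ≤ τ.length) :
    qq act lam α β k τ = qq act lam α β' k τ := by
  induction k generalizing τ with
  | zero => rfl
  | succ k ih =>
    unfold qq
    refine Finset.sum_congr rfl fun c _ => ?_
    rw [ih _ (by simp; omega), wt, wt, hb τ hτ]

lemma Wn_step {act : Γ → A} {sim : Hist Γ → Hist Γ → Prop}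
    (hsim : IsIndist act sim) {lam : Hist Γ → Bool} {α : Hist Γ → PDist A}
    (hα : IsPlayerStrat sim α) {τ : Hist Γ} (hw : Wn act sim lam α τ) (c : Γ)
    (hc : 0 < (α τ).f (act c)) : Wn act sim lam α (τ ++ [c]) := by
  intro ρ hρ β hβ
  have hlen := hsim.length_eq _ _ hρ
  have hne : ρ ≠ [] := by rintro rfl; simp at hlen
  obtain ⟨σ, d, rfl⟩ : ∃ σ d, ρ = σ ++ [d] :=
    ⟨ρ.dropLast, ρ.getLast hne, (List.dropLast_append_getLast hne).symm⟩
  obtain ⟨h1, h2⟩ := hsim.prefix_act _ _ _ _ hρ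
  let β' : Hist Γ → A → PDist Γ := fun ρ a => if ρ = σ ∧ a = act d then dirac' d else β ρ a
  have hβ' : IsEnvStrat act β' := by
    intro ρ a e he
    by_cases hcase : ρ = σ ∧ a = act d
    · simp only [β', hcase, and_self, if_true] at he
      rw [dirac'_pos he, hcase.2]
    · simp only [β', hcase, if_false] at he
      exact hβ ρ a e he
  have hlim := (hw σ h1 β' hβ').comp (Filter.tendsto_add_atTop_nat 1)
  have hpos : 0 < (α σ).f (act d) := by rw [hα σ τ h1, h2]; exact hc
  have hlim2 := hlim.const_mul ((α σ).f (act d))⁻¹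
  rw [mul_zero] at hlim2
  refine squeeze_zero (fun k => qq_nonneg ..) (fun k => ?_) hlim2
  simp only [Function.comp]
  rw [le_inv_mul_iff₀ hpos, qq.eq_2]
  have hq : qq act lam α β k (σ ++ [d]) = qq act lam α β' k (σ ++ [d]) := by
    refine qq_congr act lam α β β' (σ.length + 1) ?_ k _ (by simp)
    intro ρ hl
    funext a
    have : ρ ≠ σ := by rintro rfl; omega
    simp [β', this]
  rw [hq]
  have hwt : wt act α β' σ d = (α σ).f (act d) := by
    simp [wt, β', dirac']
  rw [← hwt]
  exact Finset.single_le_sum (f := fun c => wt act α β' σ c * qq act lam α β' k (σ ++ [c]))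
    (fun c _ => mul_nonneg (wt_nonneg ..) (qq_nonneg ..)) (Finset.mem_univ d)

lemma approx_symm {act : Γ → A} {sim : Hist Γ → Hist Γ → Prop} (hsim : IsIndist act sim)
    {h : Hist Γ → P} {p p' : P} (hp : approx sim h p p') : approx sim h p' p := by
  obtain ⟨τ, τ', h1, h2, h3⟩ := hp
  exact ⟨τ', τ, hsim.equiv.symm h1, h3, h2⟩

lemma approx_lift {sim : Hist Γ → Hist Γ → Prop} {lam : Hist Γ → Bool}
    {h : Hist Γ → P} (hh : IsRectMorphism sim lam h) {p' : P} {τ : Hist Γ}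
    (hp : approx sim h p' (h τ)) : ∃ τ', sim τ' τ ∧ h τ' = p' := by
  obtain ⟨σ', σ, h1, h2, h3⟩ := hp
  have := hh.rect σ τ h3
  have hm : p' ∈ h '' InfoSet sim σ := ⟨σ', h1, h2⟩
  rw [this] at hm
  exact hm

lemma exists_sub_Y {act : Γ → A} (hact : Function.Surjective act)
    {sim : Hist Γ → Hist Γ → Prop} (hsim : IsIndist act sim)
    {lam : Hist Γ → Bool} (habs : Absorbing lam)
    {h : Hist Γ → P} (hh : IsRectMorphism sim lam h)
    {δP : P → Γ → P} (hδ : ∀ (τ : Hist Γ) (c : Γ), δP (h τ) c = h (τ ++ [c]))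
    {τ : Hist Γ} {α : Hist Γ → PDist A} (hα : IsPlayerStrat sim α)
    (hw : Wn act sim lam α τ) : Sum.inl (h τ) ∈ Ystar sim h act δP lam := by
  let Y0 : Set (P ⊕ P × A) := {s | match s with
    | Sum.inl p => ∃ (τ : Hist Γ) (α : Hist Γ → PDist A), h τ = p ∧ IsPlayerStrat sim α ∧
        Wn act sim lam α τ
    | Sum.inr (p, a) => ∃ (τ : Hist Γ) (α : Hist Γ → PDist A), h τ = p ∧ IsPlayerStrat sim α ∧
        Wn act sim lam α τ ∧ 0 < (α τ).f a}
  have hint : ∀ s ∈ Y0, s ∈ intr (approxS sim h) Y0 := by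
    rintro (p | ⟨p, a⟩) hs (p' | ⟨p', a'⟩) hr
    · obtain ⟨τ, α, rfl, hα, hw⟩ := hs
      obtain ⟨τ', h1, h2⟩ := approx_lift hh hr
      exact ⟨τ', α, h2, hα, fun ρ hρ => hw ρ (hsim.equiv.trans hρ h1)⟩
    · exact hr.elim
    · exact hr.elim
    · obtain ⟨τ, α, rfl, hα, hw, hpos⟩ := hs
      obtain ⟨hr, rfl⟩ := hr
      obtain ⟨τ', h1, h2⟩ := approx_lift hh hr
      refine ⟨τ', α, h2, hα, fun ρ hρ => hw ρ (hsim.equiv.trans hρ h1), ?_⟩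
      rw [hα _ _ h1]
      exact hpos
  let L := OrderHom.lfp (innerOp sim h act δP lam Y0)
  have hL : intr (approxS sim h) Y0 ∩ (Pre act δP L ∪ targetS A lam h) = L :=
    (innerOp sim h act δP lam Y0).map_lfp
  have hinl : ∀ (τ : Hist Γ) (α : Hist Γ → PDist A), IsPlayerStrat sim α →
      Wn act sim lam α τ → Sum.inl (h τ) ∈ L := by
    intro τ α hα hw
    by_contra hnot
    have hch : ∀ (σ : Hist Γ) (a : A), ∃ c, act c = a ∧
        ((∃ c', act c' = a ∧ Sum.inl (h (σ ++ [c'])) ∉ L) → Sum.inl (h (σ ++ [c])) ∉ L) := by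
      intro σ a
      by_cases hex : ∃ c', act c' = a ∧ Sum.inl (h (σ ++ [c'])) ∉ L
      · obtain ⟨c, h1, h2⟩ := hex
        exact ⟨c, h1, fun _ => h2⟩
      · obtain ⟨c, hc⟩ := hact a
        exact ⟨c, hc, fun hx => (hex hx).elim⟩
    choose cc hc1 hc2 using hch
    let β : Hist Γ → A → PDist Γ := fun σ a => dirac' (cc σ a)
    have hβ : IsEnvStrat act β := by
      intro σ a c hc
      rw [dirac'_pos hc, hc1]
    have hone : ∀ k (σ : Hist Γ), Wn act sim lam α σ → Sum.inl (h σ) ∉ L →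
        qq act lam α β k σ = 1 := by
      intro k
      induction k with
      | zero =>
        intro σ hwσ hσ
        have : ¬ lam σ = true := by
          intro hl
          apply hσ
          rw [← hL]
          exact ⟨hint _ ⟨σ, α, rfl, hα, hwσ⟩, Or.inr ⟨h σ, ⟨σ, rfl, hl⟩, rfl⟩⟩
        simp [qq, this]
      | succ k ih =>
        intro σ hwσ hσ
        rw [qq, ← wt_sum α hβ σ]
        refine Finset.sum_congr rfl fun c _ => ?_
        by_cases hz : wt act α β σ c = 0
        · rw [hz, zero_mul]
        · have hαc : 0 < (α σ).f (act c) :=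
            lt_of_le_of_ne ((α σ).nonneg _) (fun he => hz (by rw [wt, ← he, zero_mul]))
          have hβc : 0 < (β σ (act c)).f c :=
            lt_of_le_of_ne ((β σ _).nonneg _) (fun he => hz (by rw [wt, ← he, mul_zero]))
          have hcc : c = cc σ (act c) := dirac'_pos hβc
          rw [ih _ (Wn_step hsim hα hwσ c hαc), mul_one]
          rw [hcc]
          apply hc2
          by_contra hno
          push Not at hno
          apply hσ
          rw [← hL]
          refine ⟨hint _ ⟨σ, α, rfl, hα, hwσ⟩, Or.inl ⟨act c, ?_⟩⟩
          rw [← hL]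
          refine ⟨hint _ ⟨σ, α, rfl, hα, hwσ, hαc⟩, Or.inl ?_⟩
          intro d hd
          rw [hδ]
          exact hno d hd
    have hlim := hw τ (hsim.equiv.refl τ) β hβ
    simp only [hone _ τ hw hnot] at hlim
    exact one_ne_zero (tendsto_nhds_unique tendsto_const_nhds hlim)
  have hY : Y0 ≤ outerOp sim h act δP lam Y0 := by
    change Y0 ⊆ L
    rintro (p | ⟨p, a⟩) hs
    · obtain ⟨τ, α, rfl, hα, hw⟩ := hs
      exact hinl τ α hα hw
    · have hi := hint _ hs
      obtain ⟨τ, α, rfl, hα, hw, hpos⟩ := hs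
      rw [← hL]
      refine ⟨hi, Or.inl ?_⟩
      rintro c rfl
      rw [hδ]
      exact hinl _ α hα (Wn_step hsim hα hw c hpos)
  exact OrderHom.le_gfp _ hY ⟨τ, α, rfl, hα, hw⟩

/-- Uniform distribution on a nonempty finset. -/
noncomputable def unif (s : Finset A) (hs : s.Nonempty) : PDist A where
  f := fun a => if a ∈ s then (s.card : ℝ)⁻¹ else 0
  nonneg := fun a => by split_ifs <;> positivity
  sum_one := by
    have : (s.card : ℝ) ≠ 0 := by exact_mod_cast hs.card_pos.ne'
    simp [this]

/-- Uniform distribution on a set if nonempty, otherwise on everything. -/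
noncomputable def unifOr [Nonempty A] (s : Set A) : PDist A :=
  if hs : (Finset.univ.filter (· ∈ s)).Nonempty then unif _ hs
  else unif Finset.univ Finset.univ_nonempty

lemma unifOr_pos [Nonempty A] {s : Set A} {a : A} (hs : s.Nonempty)
    (hp : 0 < (unifOr s).f a) : a ∈ s := by
  obtain ⟨b, hb⟩ := hs
  have : (Finset.univ.filter (· ∈ s)).Nonempty := ⟨b, by simp [hb]⟩
  rw [unifOr, dif_pos this] at hp
  by_contra hne
  simp [unif, hne] at hp

lemma unifOr_ge [Nonempty A] {s : Set A} {a : A} (ha : a ∈ s) :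
    0 < (unifOr s).f a := by
  have : (Finset.univ.filter (· ∈ s)).Nonempty := ⟨a, by simp [ha]⟩
  rw [unifOr, dif_pos this]
  have h2 : 0 < ((Finset.univ.filter (· ∈ s)).card : ℝ) := by exact_mod_cast this.card_pos
  simp only [unif, Finset.mem_filter, Finset.mem_univ, true_and, ha, if_true]
  exact inv_pos.2 h2

lemma Y_sub {act : Γ → A} [Nonempty A] [Fintype P]
    {sim : Hist Γ → Hist Γ → Prop} (hsim : IsIndist act sim)
    {lam : Hist Γ → Bool} (habs : Absorbing lam)
    {h : Hist Γ → P} (hh : IsRectMorphism sim lam h)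
    {δP : P → Γ → P} (hδ : ∀ (τ : Hist Γ) (c : Γ), δP (h τ) c = h (τ ++ [c]))
    {τ : Hist Γ} (hτ : Sum.inl (h τ) ∈ Ystar sim h act δP lam) :
    ∃ α : Hist Γ → PDist A, IsPlayerStrat sim α ∧ Wn act sim lam α τ := by
  set Y := Ystar sim h act δP lam with hYdef
  have hY1 : OrderHom.lfp (innerOp sim h act δP lam Y) = Y :=
    (outerOp sim h act δP lam).map_gfp
  have hY2 : intr (approxS sim h) Y ∩ (Pre act δP Y ∪ targetS A lam h) = Y := by
    have := (innerOp sim h act δP lam Y).map_lfp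
    rw [hY1] at this
    exact this
  have hint : ∀ s ∈ Y, s ∈ intr (approxS sim h) Y := by
    intro s hs
    rw [← hY2] at hs
    exact hs.1
  have hstepA : ∀ (σ : Hist Γ), Sum.inl (h σ) ∈ Y → ¬ lam σ = true →
      ∃ a, Sum.inr (h σ, a) ∈ Y := by
    intro σ hσ hl
    rw [← hY2] at hσ
    rcases hσ.2 with hp | ⟨p, ⟨ρ, h1, h2⟩, h3⟩
    · exact hp
    · refine (hl ?_).elim
      rw [← h2]
      apply hh.refines
      rw [h1]
      exact (Sum.inl.inj h3).symm
  have hstepC : ∀ (σ : Hist Γ) (c : Γ), Sum.inr (h σ, act c) ∈ Y →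
      Sum.inl (h (σ ++ [c])) ∈ Y := by
    intro σ c hσ
    rw [← hY2] at hσ
    rcases hσ.2 with hp | ⟨p, _, h3⟩
    · have := hp c rfl
      rwa [hδ] at this
    · exact absurd h3 (by simp)
  let Act : P → Set A := fun p => {a | Sum.inr (p, a) ∈ Y}
  let α : Hist Γ → PDist A := fun σ => unifOr (Act (h σ))
  have hα : IsPlayerStrat sim α := by
    have key : ∀ σ σ' : Hist Γ, sim σ σ' → Act (h σ) ⊆ Act (h σ') := by
      intro σ σ' hs a ha
      exact hint _ ha (Sum.inr (h σ', a)) ⟨⟨σ', σ, hsim.equiv.symm hs, rfl, rfl⟩, rfl⟩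
    intro σ σ' hs
    have : Act (h σ) = Act (h σ') :=
      Set.Subset.antisymm (key σ σ' hs) (key σ' σ (hsim.equiv.symm hs))
    simp only [α, this]
  refine ⟨α, hα, ?_⟩
  intro τ' hτ' β hβ
  have hτY : Sum.inl (h τ') ∈ Y := hint _ hτ (Sum.inl (h τ')) ⟨τ', τ, hτ', rfl, rfl⟩
  -- staying inside Y
  have hstay : ∀ (σ : Hist Γ) (c : Γ), Sum.inl (h σ) ∈ Y → ¬ lam σ = true →
      wt act α β σ c ≠ 0 → Sum.inl (h (σ ++ [c])) ∈ Y := by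
    intro σ c hσ hl hz
    have hαc : 0 < (α σ).f (act c) :=
      lt_of_le_of_ne ((α σ).nonneg _) (fun he => hz (by rw [wt, ← he, zero_mul]))
    exact hstepC σ c (unifOr_pos (s := Act (h σ)) (hstepA σ hσ hl) hαc)
  -- progress
  let X : Set (P ⊕ P × A) := {s | s ∈ Y ∧ match s with
    | Sum.inl p => ∃ (r : ℕ) (e : ℝ), 0 < e ∧ ∀ σ : Hist Γ, h σ = p →
        qq act lam α β r σ ≤ 1 - e
    | Sum.inr (p, a) => ∃ (r : ℕ) (e : ℝ), 0 < e ∧ ∀ σ : Hist Γ, h σ = p →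
        ∀ c, act c = a → qq act lam α β r (σ ++ [c]) ≤ 1 - e}
  have hXY : X ⊆ Y := fun s hs => hs.1
  have hXle : innerOp sim h act δP lam Y X ≤ X := by
    change intr (approxS sim h) Y ∩ (Pre act δP X ∪ targetS A lam h) ⊆ X
    rintro s ⟨hs1, hs2⟩
    have hsY : s ∈ Y := by
      rw [← hY2]
      refine ⟨hs1, hs2.imp (fun hp => Pre_mono act δP hXY hp) id⟩
    refine ⟨hsY, ?_⟩
    rcases s with p | ⟨p, a⟩
    · rcases hs2 with ⟨a, haY, r, e, he, hr⟩ | ⟨p', ⟨ρ, h1, h2⟩, h3⟩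
      · refine ⟨r + 1, (unifOr (Act p)).f a * e, mul_pos (unifOr_ge haY) he, ?_⟩
        rintro σ rfl
        rw [qq]
        have hsum : ∑ c, wt act α β σ c * (if act c = a then e else 0) = (α σ).f a * e := by
          have h1 : ∀ c, wt act α β σ c * (if act c = a then e else 0) =
              (α σ).f a * e * (β σ a).f c := by
            intro c
            by_cases hc : act c = a
            · subst hc; simp [wt]; ring
            · simp [hc, env_zero hβ σ a c hc]
          simp_rw [h1, ← Finset.mul_sum, (β σ a).sum_one, mul_one]
        change _ ≤ 1 - (α σ).f a * e
        rw [← hsum, ← wt_sum α hβ σ, ← Finset.sum_sub_distrib]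
        refine Finset.sum_le_sum fun c _ => ?_
        rw [← mul_one_sub]
        refine mul_le_mul_of_nonneg_left ?_ (wt_nonneg ..)
        split_ifs with hc
        · exact hr σ rfl c hc
        · rw [sub_zero]; exact qq_le_one lam α hβ _ _
      · refine ⟨0, 1, one_pos, ?_⟩
        intro σ hσ
        have hl : lam σ = true := by
          rw [← h2]
          apply hh.refines
          rw [hσ, h1]
          exact (Sum.inl.inj h3).symm
        simp [qq, hl]
    · rcases hs2 with hp | ⟨p', _, h3⟩
      · have hp' : ∀ c, ∃ (r : ℕ) (e : ℝ), 0 < e ∧ (act c = a → ∀ σ : Hist Γ, h σ = δP p c →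
            qq act lam α β r σ ≤ 1 - e) := by
          intro c
          by_cases hc : act c = a
          · obtain ⟨_, r, e, he, hr⟩ := hp c hc
            exact ⟨r, e, he, fun _ => hr⟩
          · exact ⟨0, 1, one_pos, fun h => (hc h).elim⟩
        choose r e he hr using hp'
        obtain ⟨e0, he0, hle⟩ : ∃ e0 : ℝ, 0 < e0 ∧ ∀ c, e0 ≤ e c := by
          by_cases hne : Nonempty Γ
          · exact ⟨Finset.univ.inf' Finset.univ_nonempty e,
              (Finset.lt_inf'_iff _).2 fun c _ => he c, fun c => Finset.inf'_le _ (by simp)⟩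
          · exact ⟨1, one_pos, fun c => (hne ⟨c⟩).elim⟩
        refine ⟨Finset.univ.sup r, e0, he0, ?_⟩
        rintro σ rfl c hc
        refine (qq_anti habs α hβ (σ ++ [c])
          (Finset.le_sup (f := r) (Finset.mem_univ c))).trans ?_
        refine (hr c hc (σ ++ [c]) (hδ σ c).symm).trans ?_
        have := hle c
        linarith
      · exact absurd h3 (by simp)
  have hYX : Y ⊆ X := by
    have := OrderHom.lfp_le _ hXle
    rwa [hY1] at this
  obtain ⟨N, d, hd0, hd1, hN⟩ : ∃ (N : ℕ) (d : ℝ), 0 ≤ d ∧ d < 1 ∧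
      ∀ σ : Hist Γ, Sum.inl (h σ) ∈ Y → qq act lam α β N σ ≤ d := by
    have hp' : ∀ p : P, ∃ (r : ℕ) (e : ℝ), 0 < e ∧ (Sum.inl p ∈ Y → ∀ σ : Hist Γ, h σ = p →
            qq act lam α β r σ ≤ 1 - e) := by
      intro p
      by_cases hc : Sum.inl p ∈ Y
      · obtain ⟨_, r, e, he, hr⟩ := hYX hc
        exact ⟨r, e, he, fun _ => hr⟩
      · exact ⟨0, 1, one_pos, fun h => (hc h).elim⟩
    choose r e he hr using hp'
    have : Nonempty P := ⟨h τ⟩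
    let e0 := Finset.univ.inf' Finset.univ_nonempty e
    have he0 : 0 < e0 := (Finset.lt_inf'_iff _).2 fun c _ => he c
    have hb : ∀ σ : Hist Γ, Sum.inl (h σ) ∈ Y →
        qq act lam α β (Finset.univ.sup r) σ ≤ 1 - e0 := by
      intro σ hσ
      refine (qq_anti habs α hβ σ (Finset.le_sup (f := r) (Finset.mem_univ (h σ)))).trans ?_
      refine (hr (h σ) hσ σ rfl).trans ?_
      have : e0 ≤ e (h σ) := Finset.inf'_le _ (by simp)
      linarith
    exact ⟨Finset.univ.sup r, 1 - e0, (qq_nonneg ..).trans (hb τ' hτY), by linarith, hb⟩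
  have hcomp : ∀ k (σ : Hist Γ), Sum.inl (h σ) ∈ Y →
      qq act lam α β (k + N) σ ≤ d * qq act lam α β k σ := by
    intro k
    induction k with
    | zero =>
      intro σ hσ
      rw [zero_add]
      by_cases hl : lam σ = true
      · rw [qq_zero_of_lam act habs α β N σ hl]
        exact mul_nonneg hd0 (qq_nonneg ..)
      · simpa [qq, hl] using hN σ hσ
    | succ k ih =>
      intro σ hσ
      by_cases hl : lam σ = true
      · rw [qq_zero_of_lam act habs α β _ σ hl]
        exact mul_nonneg hd0 (qq_nonneg ..)
      · rw [show k + 1 + N = (k + N) + 1 by ring, qq, qq, Finset.mul_sum]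
        refine Finset.sum_le_sum fun c _ => ?_
        by_cases hz : wt act α β σ c = 0
        · simp [hz]
        · have := mul_le_mul_of_nonneg_left (ih _ (hstay σ c hσ hl hz)) (wt_nonneg act α β σ c)
          linarith
  have hpow : ∀ j, qq act lam α β (j * N) τ' ≤ d ^ j := by
    intro j
    induction j with
    | zero => simpa using qq_le_one lam α hβ 0 τ'
    | succ j ih =>
      rw [add_mul, one_mul, pow_succ, mul_comm (d ^ j)]
      exact (hcomp _ τ' hτY).trans (mul_le_mul_of_nonneg_left ih hd0)
  rw [Metric.tendsto_atTop]
  intro ε hε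
  obtain ⟨j, hj⟩ := exists_pow_lt_of_lt_one hε hd1
  refine ⟨j * N, fun k hk => ?_⟩
  rw [Real.dist_eq, sub_zero, abs_of_nonneg (qq_nonneg ..)]
  exact ((qq_anti habs α hβ τ' hk).trans (hpow j)).trans_lt hj

end Helpers

/-- Theorem 1 (fixpoint characterization): Y* ∩ P = P_∀ = P_∃. -/
theorem fixpoint_characterization {Γ A P : Type} [Fintype Γ] [Nonempty Γ] [Fintype A] [Nonempty A] [Fintype P]
    (act : Γ → A) (hact : Function.Surjective act)
    (sim : Hist Γ → Hist Γ → Prop) (hsim : IsIndist act sim)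
    (lam : Hist Γ → Bool) (hcons : InfoConsistent sim lam) (habs : Absorbing lam)
    (h : Hist Γ → P) (hh : IsRectMorphism sim lam h)
    (δP : P → Γ → P) (hδ : ∀ (τ : Hist Γ) (c : Γ), δP (h τ) c = h (τ ++ [c])) :
    {p : P | Sum.inl p ∈ Ystar sim h act δP lam} = Pforall act sim lam h ∧
    Pforall act sim lam h = Pexists act sim lam h := by
  have h1 : {p : P | Sum.inl p ∈ Ystar sim h act δP lam} ⊆ Pforall act sim lam h := by
    rintro _ hp τ rfl
    obtain ⟨α, hα, hw⟩ := Y_sub hsim habs hh hδ hp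
    exact ⟨α, hα, (win_iff habs α τ).2 hw⟩
  have h2 : Pforall act sim lam h ⊆ Pexists act sim lam h := by
    intro p hp
    obtain ⟨τ, hτ⟩ := hh.surj p
    exact ⟨τ, hτ, hp τ hτ⟩
  have h3 : Pexists act sim lam h ⊆ {p : P | Sum.inl p ∈ Ystar sim h act δP lam} := by
    rintro _ ⟨τ, rfl, α, hα, hw⟩
    exact exists_sub_Y hact hsim habs hh hδ hα ((win_iff habs α τ).1 hw)
  exact ⟨h1.antisymm (h2.trans h3), h2.antisymm (h3.trans h1)⟩
end

section
/- Let ~ be an indistinguishability relation on Γ*, λ an information-consistent absorbing coloring, and h : Γ* → P a rectangular morphism. The player has an almost-sure winning strategy from the empty history ε (whose information set [ε]~ is {ε}) for the reachability objective if and only if h(ε) ∈ Y*. -/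
open MeasureTheory
open scoped Classical

namespace ASWin

section Basic

variable {Γ A P : Type} [Fintype Γ] [Fintype A]

/-- One-step probability of the move `c` after the history `τ`. -/
noncomputable def stepW (act : Γ → A) (α : Hist Γ → PDist A) (β : Hist Γ → A → PDist Γ)
    (τ : Hist Γ) (c : Γ) : ℝ := (α τ).f (act c) * (β τ (act c)).f c

variable (act : Γ → A) (α : Hist Γ → PDist A) (β : Hist Γ → A → PDist Γ)

lemma stepW_nonneg (τ : Hist Γ) (c : Γ) : 0 ≤ stepW act α β τ c :=
  mul_nonneg ((α τ).nonneg _) ((β τ _).nonneg _)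

variable {act β} in
lemma env_sum (hβ : IsEnvStrat act β) (τ : Hist Γ) (a : A) (g : Γ → ℝ) :
    ∑ c, (β τ a).f c * g c = ∑ c, if act c = a then (β τ (act c)).f c * g c else 0 := by
  refine Finset.sum_congr rfl fun c _ => ?_
  split_ifs with hc
  · rw [hc]
  · have h0 : (β τ a).f c = 0 := by
      by_contra hne
      exact hc (hβ τ a c (lt_of_le_of_ne ((β τ a).nonneg c) (Ne.symm hne)))
    rw [h0, zero_mul]

variable {act β} in
lemma stepW_sum_mul (hβ : IsEnvStrat act β) (τ : Hist Γ) (g : Γ → ℝ) :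
    ∑ c, stepW act α β τ c * g c = ∑ a, (α τ).f a * ∑ c, (β τ a).f c * g c := by
  simp_rw [env_sum hβ]
  simp_rw [Finset.mul_sum]
  rw [Finset.sum_comm]
  refine Finset.sum_congr rfl fun c _ => ?_
  rw [Finset.sum_eq_single (act c)]
  · simp [stepW, mul_assoc]
  · intro b _ hb
    rw [if_neg (Ne.symm hb), mul_zero]
  · simp

variable {act β} in
lemma stepW_sum (hβ : IsEnvStrat act β) (τ : Hist Γ) : ∑ c, stepW act α β τ c = 1 := by
  have := stepW_sum_mul α hβ τ (fun _ => 1)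
  simp only [mul_one] at this
  rw [this]
  simp [(β τ _).sum_one, (α τ).sum_one]

lemma extProb_concat (τ l : Hist Γ) (c : Γ) :
    extProb act α β τ (l ++ [c]) = extProb act α β τ l * stepW act α β (τ ++ l) c := by
  induction l generalizing τ with
  | nil => simp [extProb, stepW]
  | cons d l ih => simp [extProb, ih, mul_assoc]

lemma extProb_nonneg (τ l : Hist Γ) : 0 ≤ extProb act α β τ l := by
  induction l generalizing τ with
  | nil => simp [extProb]
  | cons d l ih => exact mul_nonneg (stepW_nonneg act α β τ d) (ih _)


lemma mem_Cyl_concat (π : Play Γ) (ρ : Hist Γ) (c : Γ) :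
    π ∈ Cyl (ρ ++ [c]) ↔ π ∈ Cyl ρ ∧ π ρ.length = c := by
  simp only [Cyl, Set.mem_ofPred_eq, Fin.forall_iff, List.get_eq_getElem]
  constructor
  · intro H
    refine ⟨fun i hi => ?_, ?_⟩
    · have := H i (by simp; omega)
      rwa [List.getElem_append_left hi] at this
    · simpa using H ρ.length (by simp)
  · rintro ⟨H1, H2⟩ i hi
    by_cases h : i < ρ.length
    · rw [List.getElem_append_left h]; exact H1 i h
    · have : i = ρ.length := by simp at hi; omega
      subst this
      simpa using H2


lemma Cyl_nil : Cyl ([] : Hist Γ) = Set.univ := by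
  ext π; simp [Cyl]


lemma mem_Cyl_iff (π : Play Γ) (ρ : Hist Γ) :
    π ∈ Cyl ρ ↔ (List.ofFn fun i : Fin ρ.length => π i.1) = ρ := by
  constructor
  · intro H
    apply List.ext_getElem
    · simp
    · intro i h1 h2
      simpa using H ⟨i, h2⟩
  · intro H i
    have := List.getElem_of_eq H (i := i.1) (by simp)
    simpa using this


lemma mem_Cyl_ofFn (π : Play Γ) (n : ℕ) :
    π ∈ Cyl (List.ofFn fun i : Fin n => π i.1) := by
  intro i; simp

variable {act α β} in
lemma pr_cyl {μ : Measure (Play Γ)} (hμ : IsPrMeasure act α β [] μ) (ρ : Hist Γ) :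
    μ (Cyl ρ) = ENNReal.ofReal (extProb act α β [] ρ) := by
  rw [hμ.2 ρ]
  by_cases h : ρ = []
  · subst h; simp [extProb]
  · simp [h]

/-- The history of length `n` produced by the sample `ω`. -/
def genPre (ω : Hist Γ → Γ) : ℕ → Hist Γ
  | 0 => []
  | n + 1 => genPre ω n ++ [ω (genPre ω n)]

/-- The play produced by the sample `ω`. -/
def genPlay (ω : Hist Γ → Γ) : Play Γ := fun n => ω (genPre ω n)


lemma genPre_eq (ω : Hist Γ → Γ) (ρ : Hist Γ) (hρ : genPlay ω ∈ Cyl ρ) :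
    genPre ω ρ.length = ρ := by
  induction ρ using List.reverseRecOn with
  | nil => rfl
  | append_singleton ρ c ih =>
    rw [mem_Cyl_concat] at hρ
    have h1 := ih hρ.1
    have h2 := hρ.2
    rw [genPlay, h1] at h2
    simp [genPre, h1, h2]


lemma genPlay_mem_concat (ω : Hist Γ → Γ) (ρ : Hist Γ) (c : Γ) :
    genPlay ω ∈ Cyl (ρ ++ [c]) ↔ genPlay ω ∈ Cyl ρ ∧ ω ρ = c := by
  rw [mem_Cyl_concat]
  refine and_congr_right fun H => ?_
  rw [genPlay, genPre_eq ω ρ H]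

variable {act β} in
lemma exists_pr (hβ : IsEnvStrat act β) : ∃ μ, IsPrMeasure act α β [] μ := by
  let _ : MeasurableSpace Γ := ⊤
  have hsum : ∀ τ, ∑ c, ENNReal.ofReal (stepW act α β τ c) = 1 := by
    intro τ
    rw [← ENNReal.ofReal_sum_of_nonneg (fun c _ => stepW_nonneg act α β τ c),
      stepW_sum α hβ, ENNReal.ofReal_one]
  let p : Hist Γ → Measure Γ := fun τ =>
    (PMF.ofFintype (fun c => ENNReal.ofReal (stepW act α β τ c)) (hsum τ)).toMeasure
  have hp : ∀ τ c, p τ {c} = ENNReal.ofReal (stepW act α β τ c) := by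
    intro τ c
    simp only [p]
    rw [PMF.toMeasure_apply_singleton _ _ (measurableSet_singleton c)]
    simp
  have : ∀ τ, IsProbabilityMeasure (p τ) := fun τ => by simp only [p]; infer_instance
  have key : ∀ ρ : Hist Γ, ∃ (s : Finset (Hist Γ)) (t : Hist Γ → Set Γ),
      (∀ σ ∈ s, σ.length < ρ.length) ∧ genPlay ⁻¹' (Cyl ρ) = Set.pi s t ∧
      ∏ σ ∈ s, p σ (t σ) = ENNReal.ofReal (extProb act α β [] ρ) := by
    intro ρ
    induction ρ using List.reverseRecOn with
    | nil => exact ⟨∅, fun _ => ∅, by simp, by simp [Cyl_nil], by simp [extProb]⟩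
    | append_singleton ρ c ih =>
      obtain ⟨s, t, h1, h2, h3⟩ := ih
      have hns : ρ ∉ s := fun hm => lt_irrefl _ (h1 ρ hm)
      refine ⟨insert ρ s, Function.update t ρ {c}, ?_, ?_, ?_⟩
      · intro σ hσ
        rcases Finset.mem_insert.1 hσ with rfl | hσ
        · simp
        · have := h1 σ hσ; simp; omega
      · ext ω
        have h2' : genPlay ω ∈ Cyl ρ ↔ ω ∈ Set.pi s t := by rw [← h2]; rfl
        simp only [Set.mem_preimage]
        rw [genPlay_mem_concat, h2']
        simp only [Set.mem_pi, Finset.coe_insert, Set.mem_insert_iff, Finset.mem_coe]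
        constructor
        · rintro ⟨H1, H2⟩ σ (rfl | hσ)
          · simpa using H2
          · have : σ ≠ ρ := by rintro rfl; exact hns hσ
            simpa [this] using H1 σ hσ
        · intro H
          refine ⟨fun σ hσ => ?_, ?_⟩
          · have : σ ≠ ρ := by rintro rfl; exact hns hσ
            simpa [this] using H σ (Or.inr hσ)
          · simpa using H ρ (Or.inl rfl)
      · rw [Finset.prod_insert hns, extProb_concat,
          ENNReal.ofReal_mul (extProb_nonneg act α β _ _), ← h3, mul_comm]
        congr 1
        · refine Finset.prod_congr rfl fun σ hσ => ?_
          have : σ ≠ ρ := by rintro rfl; exact hns hσ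
          simp [this]
        · simp [hp]
  have hmeas : @Measurable _ _ _ (playMS (Γ := Γ)) (genPlay (Γ := Γ)) := by
    refine measurable_generateFrom ?_
    rintro _ ⟨ρ, rfl⟩
    obtain ⟨s, t, -, h2, -⟩ := key ρ
    rw [h2]
    exact MeasurableSet.pi s.countable_toSet fun _ _ => trivial
  refine ⟨@Measure.map _ _ _ (playMS (Γ := Γ)) genPlay (Measure.infinitePi p), ?_, ?_⟩
  · exact @Measure.isProbabilityMeasure_map _ _ _ (playMS (Γ := Γ)) _ _ _ hmeas.aemeasurable
  · intro ρ
    rw [@Measure.map_apply _ _ _ (playMS (Γ := Γ)) _ _ hmeas _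
      (MeasurableSpace.measurableSet_generateFrom ⟨ρ, rfl⟩)]
    obtain ⟨s, t, -, h2, h3⟩ := key ρ
    rw [h2, Measure.infinitePi_pi p (fun _ _ => trivial), h3]
    by_cases h : ρ = []
    · subst h; simp [extProb]
    · simp [h]

end Basic

section Forward

variable {Γ A P : Type} [Fintype Γ] [Fintype A]

lemma lam_prefix {lam : Hist Γ → Bool} (habs : Absorbing lam) {ρ ρ' : Hist Γ}
    (hp : ρ <+: ρ') (hl : lam ρ = true) : lam ρ' = true := by
  obtain ⟨l, rfl⟩ := hp
  induction l using List.reverseRecOn with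
  | nil => simpa using hl
  | append_singleton l c ih => rw [← List.append_assoc]; exact habs _ _ ih

lemma ofFn_succ_play (π : Play Γ) (n : ℕ) : (List.ofFn fun i : Fin (n + 1) => π i.1) =
    (List.ofFn fun i : Fin n => π i.1) ++ [π n] := by
  rw [List.ofFn_succ']; simp

lemma ofFn_prefix (π : Play Γ) {n m : ℕ} (hnm : n ≤ m) :
    (List.ofFn fun i : Fin n => π i.1) <+: (List.ofFn fun i : Fin m => π i.1) := by
  induction m, hnm using Nat.le_induction with
  | base => exact List.prefix_rfl
  | succ m _ ih => rw [ofFn_succ_play]; exact ih.trans (List.prefix_append _ _)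

lemma approx_lift {sim : Hist Γ → Hist Γ → Prop} {lam : Hist Γ → Bool} {h : Hist Γ → P}
    (hh : IsRectMorphism sim lam h) {p : P} {τ : Hist Γ} (hp : approx sim h p (h τ)) :
    ∃ τ', sim τ' τ ∧ h τ' = p := by
  obtain ⟨τ1, τ2, h1, h2, h3⟩ := hp
  have : p ∈ h '' InfoSet sim τ2 := ⟨τ1, h1, h2⟩
  rw [hh.rect τ2 τ h3] at this
  exact this

/-- Histories consistent with the strategy. -/
def Cons (act : Γ → A) (α : Hist Γ → PDist A) (τ : Hist Γ) : Prop :=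
  ∀ σ c, σ ++ [c] <+: τ → 0 < (α σ).f (act c)

lemma cons_nil (act : Γ → A) (α : Hist Γ → PDist A) : Cons act α [] := by
  intro σ c hp; simp at hp

lemma cons_concat (act : Γ → A) (α : Hist Γ → PDist A) (τ : Hist Γ) (c : Γ) :
    Cons act α (τ ++ [c]) ↔ Cons act α τ ∧ 0 < (α τ).f (act c) := by
  constructor
  · intro H
    exact ⟨fun σ d hd => H σ d (hd.trans (List.prefix_append _ _)), H τ c List.prefix_rfl⟩
  · rintro ⟨H1, H2⟩ σ d hd
    rcases List.prefix_concat_iff.1 hd with he | he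
    · obtain ⟨rfl, hc⟩ := List.append_inj' he rfl
      obtain rfl : d = c := by simpa using hc
      exact H2
    · exact H1 σ d he

lemma cons_sim {act : Γ → A} {sim : Hist Γ → Hist Γ → Prop} (hsim : IsIndist act sim)
    {α : Hist Γ → PDist A} (hα : IsPlayerStrat sim α) (τ τ' : Hist Γ) (hs : sim τ' τ)
    (hc : Cons act α τ) : Cons act α τ' := by
  induction τ using List.reverseRecOn generalizing τ' with
  | nil =>
    have := hsim.length_eq _ _ hs
    obtain rfl : τ' = [] := by simpa using this
    exact hc
  | append_singleton τ c ih =>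
    have hlen := hsim.length_eq _ _ hs
    induction τ' using List.reverseRecOn with
    | nil => simp at hlen
    | append_singleton τ' c' _ =>
      obtain ⟨h1, h2⟩ := hsim.prefix_act _ _ _ _ hs
      rw [cons_concat] at hc ⊢
      refine ⟨ih τ' h1 hc.1, ?_⟩
      rw [hα _ _ h1, h2]
      exact hc.2

lemma avoid_false {act : Γ → A} (hact : Function.Surjective act)
    {lam : Hist Γ → Bool} (habs : Absorbing lam) {α : Hist Γ → PDist A}
    (Bad : Hist Γ → Prop) (hBc : ∀ τ, Bad τ → Cons act α τ) (hBl : ∀ τ, Bad τ → lam τ ≠ true)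
    (hBs : ∀ τ a, Bad τ → 0 < (α τ).f a → ∃ c, act c = a ∧ Bad (τ ++ [c]))
    (hwin : ∀ β : Hist Γ → A → PDist Γ, IsEnvStrat act β →
      ∀ μ : Measure (Play Γ), IsPrMeasure act α β [] μ → μ (ReachEvent lam) = 1)
    (τ0 : Hist Γ) (h0 : Bad τ0) : False := by
  have hex : ∀ ρ a, ∃ c, act c = a ∧ (∀ d, ρ ++ [d] <+: τ0 → act d = a → c = d) ∧
      (τ0 <+: ρ → Bad ρ → 0 < (α ρ).f a → Bad (ρ ++ [c])) := by
    intro ρ a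
    by_cases hA : ∃ d, ρ ++ [d] <+: τ0 ∧ act d = a
    · obtain ⟨d, hd, rfl⟩ := hA
      refine ⟨d, rfl, fun e he _ => ?_, fun hp => ?_⟩
      · have := List.prefix_of_prefix_length_le hd he (by simp)
        have := this.eq_of_length (by simp)
        simpa using this
      · have h1 := hd.length_le
        have h2 := hp.length_le
        simp at h1; omega
    · push Not at hA
      by_cases hB : Bad ρ ∧ 0 < (α ρ).f a
      · obtain ⟨c, h1, h2⟩ := hBs ρ a hB.1 hB.2
        exact ⟨c, h1, fun d hd hda => absurd hda (hA d hd), fun _ _ _ => h2⟩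
      · obtain ⟨c, hc⟩ := hact a
        exact ⟨c, hc, fun d hd hda => absurd hda (hA d hd),
          fun _ h1 h2 => absurd ⟨h1, h2⟩ hB⟩
  choose g hg1 hg2 hg3 using hex
  let β : Hist Γ → A → PDist Γ := fun ρ a =>
    ⟨fun c => if c = g ρ a then 1 else 0, fun c => by split_ifs <;> norm_num, by simp⟩
  have hβ : IsEnvStrat act β := by
    intro ρ a c hc
    by_cases he : c = g ρ a
    · rw [he, hg1]
    · simp [β, he] at hc
  obtain ⟨μ, hμ⟩ := exists_pr α hβ
  have hμ1 := hμ.1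
  have hpos : ∀ ρ, ρ <+: τ0 → 0 < extProb act α β [] ρ := by
    intro ρ
    induction ρ using List.reverseRecOn with
    | nil => intro _; simp [extProb]
    | append_singleton ρ c ih =>
      intro hp
      rw [extProb_concat]
      refine mul_pos (ih ((List.prefix_append _ _).trans hp)) ?_
      have h1 := hBc τ0 h0 ρ c hp
      have h2 := hg2 ρ (act c) c hp rfl
      simp [stepW, β, h2, h1]
  have hbad : ∀ ρ, τ0 <+: ρ → 0 < extProb act α β [] ρ → Bad ρ := by
    intro ρ
    induction ρ using List.reverseRecOn with
    | nil =>
      intro hp _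
      obtain rfl : τ0 = [] := by simpa using hp
      exact h0
    | append_singleton ρ c ih =>
      intro hp hq
      rcases List.prefix_concat_iff.1 hp with he | he
      · rwa [← he]
      · rw [extProb_concat] at hq
        have q1 := pos_of_mul_pos_left hq (stepW_nonneg act α β _ c)
        have q2 := pos_of_mul_pos_right hq (extProb_nonneg act α β _ _)
        have hb := ih he q1
        simp only [List.nil_append, stepW] at q2
        have hcg : c = g ρ (act c) := by
          by_contra hne
          simp [β, hne] at q2
        have q3 := pos_of_mul_pos_left q2 ((β ρ (act c)).nonneg c)
        have := hg3 ρ (act c) he hb q3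
        rwa [← hcg] at this
  have hnull : μ (ReachEvent lam ∩ Cyl τ0) = 0 := by
    refine measure_mono_null (t := ⋃ ρ ∈ {ρ : Hist Γ | τ0 <+: ρ ∧ lam ρ = true}, Cyl ρ) ?_ ?_
    · rintro π ⟨⟨n, hn⟩, hπ⟩
      rw [mem_Cyl_iff] at hπ
      refine Set.mem_biUnion (x := List.ofFn fun i : Fin (max n τ0.length) => π i.1) ⟨?_, ?_⟩
        (mem_Cyl_ofFn π _)
      · have := ofFn_prefix π (le_max_right n τ0.length)
        rwa [hπ] at this
      · exact lam_prefix habs (ofFn_prefix π (le_max_left n τ0.length)) hn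
    · rw [measure_biUnion_null_iff (Set.to_countable _)]
      rintro ρ ⟨h1, h2⟩
      rw [pr_cyl hμ, ENNReal.ofReal_eq_zero]
      by_contra hc
      exact hBl ρ (hbad ρ h1 (not_le.1 hc)) h2
  have hcyl : μ (Cyl τ0) ≠ 0 := by
    rw [pr_cyl hμ, Ne, ENNReal.ofReal_eq_zero, not_le]
    exact hpos τ0 List.prefix_rfl
  have hR := hwin β hβ μ hμ
  have hle : μ (ReachEvent lam) ≤ μ (ReachEvent lam ∩ Cyl τ0) + μ (Cyl τ0)ᶜ := by
    refine (measure_mono ?_).trans (measure_union_le _ _)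
    intro π hπ
    by_cases hc : π ∈ Cyl τ0
    · exact Or.inl ⟨hπ, hc⟩
    · exact Or.inr hc
  rw [hnull, zero_add, hR,
    prob_compl_eq_one_sub (show MeasurableSet (Cyl τ0) from
      MeasurableSpace.measurableSet_generateFrom ⟨τ0, rfl⟩)] at hle
  exact absurd hle (not_le.2 (ENNReal.sub_lt_self ENNReal.one_ne_top one_ne_zero hcyl))

lemma forward (act : Γ → A) (hact : Function.Surjective act)
    (sim : Hist Γ → Hist Γ → Prop) (hsim : IsIndist act sim)
    (lam : Hist Γ → Bool) (habs : Absorbing lam)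
    (h : Hist Γ → P) (hh : IsRectMorphism sim lam h)
    (δP : P → Γ → P) (hδ : ∀ (τ : Hist Γ) (c : Γ), δP (h τ) c = h (τ ++ [c]))
    (α : Hist Γ → PDist A) (hα : IsPlayerStrat sim α)
    (hwin : ∀ β : Hist Γ → A → PDist Γ, IsEnvStrat act β →
      ∀ μ : Measure (Play Γ), IsPrMeasure act α β [] μ → μ (ReachEvent lam) = 1) :
    Sum.inl (h ([] : Hist Γ)) ∈ Ystar sim h act δP lam := by
  let Y : Set (P ⊕ P × A) := {s | (∃ τ, Cons act α τ ∧ s = Sum.inl (h τ)) ∨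
    (∃ τ a, Cons act α τ ∧ 0 < (α τ).f a ∧ s = Sum.inr (h τ, a))}
  have hY1 : ∀ τ, Cons act α τ → Sum.inl (h τ) ∈ Y := fun τ hτ => Or.inl ⟨τ, hτ, rfl⟩
  have hY2 : ∀ τ a, Cons act α τ → 0 < (α τ).f a → Sum.inr (h τ, a) ∈ Y :=
    fun τ a hτ ha => Or.inr ⟨τ, a, hτ, ha, rfl⟩
  have hYint : Y ⊆ intr (approxS sim h) Y := by
    rintro s (⟨τ, hτ, rfl⟩ | ⟨τ, a, hτ, ha, rfl⟩) s' hs'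
    · rcases s' with p | ⟨p, b⟩
      · obtain ⟨τ', h1, rfl⟩ := approx_lift hh hs'
        exact hY1 τ' (cons_sim hsim hα τ τ' h1 hτ)
      · exact hs'.elim
    · rcases s' with p | ⟨p, b⟩
      · exact hs'.elim
      · obtain ⟨h0, rfl⟩ := hs'
        obtain ⟨τ', h1, rfl⟩ := approx_lift hh h0
        refine hY2 τ' b (cons_sim hsim hα τ τ' h1 hτ) ?_
        rwa [hα _ _ h1]
  set X := OrderHom.lfp (innerOp sim h act δP lam Y) with hX
  have hXmem : ∀ s, s ∈ Y → s ∈ Pre act δP X ∪ targetS A lam h → s ∈ X := by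
    intro s h1 h2
    rw [hX, ← OrderHom.map_lfp]
    exact ⟨hYint h1, h2⟩
  have hpost2 : ∀ τ a, Cons act α τ → 0 < (α τ).f a →
      (∀ c, act c = a → Sum.inl (h (τ ++ [c])) ∈ X) → Sum.inr (h τ, a) ∈ X := by
    intro τ a hτ ha hc
    refine hXmem _ (hY2 τ a hτ ha) (Or.inl ?_)
    intro c hca
    rw [hδ]
    exact hc c hca
  have claim : ∀ τ, Cons act α τ → Sum.inl (h τ) ∈ X := by
    intro τ hτ
    by_contra hn
    refine avoid_false hact habs (fun τ => Cons act α τ ∧ Sum.inl (h τ) ∉ X)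
      (fun τ hb => hb.1) ?_ ?_ hwin τ ⟨hτ, hn⟩
    · rintro τ ⟨h1, h2⟩ hl
      exact h2 (hXmem _ (hY1 τ h1) (Or.inr ⟨h τ, ⟨τ, rfl, hl⟩, rfl⟩))
    · rintro τ a ⟨h1, h2⟩ ha
      by_contra hno
      refine h2 (hXmem _ (hY1 τ h1) (Or.inl ⟨a, hpost2 τ a h1 ha fun c hca => ?_⟩))
      by_contra hcX
      refine hno ⟨c, hca, ?_, hcX⟩
      rw [cons_concat]
      exact ⟨h1, hca ▸ ha⟩
  have hpost : Y ≤ outerOp sim h act δP lam Y := by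
    rintro s (⟨τ, hτ, rfl⟩ | ⟨τ, a, hτ, ha, rfl⟩)
    · exact claim τ hτ
    · refine hpost2 τ a hτ ha fun c hca => claim _ ?_
      rw [cons_concat]
      exact ⟨hτ, hca ▸ ha⟩
  exact OrderHom.le_gfp _ hpost (hY1 [] (cons_nil act α))

end Forward

section Backward

variable {Γ A P : Type} [Fintype Γ] [Fintype A]

/-- Probability of not having reached the target within `n` steps. -/
noncomputable def missP (act : Γ → A) (α : Hist Γ → PDist A) (β : Hist Γ → A → PDist Γ)
    (lam : Hist Γ → Bool) : ℕ → Hist Γ → ℝ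
  | 0, τ => if lam τ = true then 0 else 1
  | n + 1, τ => ∑ c, stepW act α β τ c * missP act α β lam n (τ ++ [c])

variable {act : Γ → A} {α : Hist Γ → PDist A} {β : Hist Γ → A → PDist Γ} {lam : Hist Γ → Bool}

lemma missP_nonneg (n : ℕ) (τ : Hist Γ) : 0 ≤ missP act α β lam n τ := by
  induction n generalizing τ with
  | zero => rw [missP]; split_ifs <;> norm_num
  | succ n ih => exact Finset.sum_nonneg fun c _ => mul_nonneg (stepW_nonneg _ _ _ _ _) (ih _)

lemma missP_le_one (hβ : IsEnvStrat act β) (n : ℕ) (τ : Hist Γ) :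
    missP act α β lam n τ ≤ 1 := by
  induction n generalizing τ with
  | zero => rw [missP]; split_ifs <;> norm_num
  | succ n ih =>
    rw [missP, ← stepW_sum α hβ τ]
    exact Finset.sum_le_sum fun c _ =>
      mul_le_of_le_one_right (stepW_nonneg _ _ _ _ _) (ih _)

lemma missP_zero_of_lam (habs : Absorbing lam) (n : ℕ) (τ : Hist Γ) (hl : lam τ = true) :
    missP act α β lam n τ = 0 := by
  induction n generalizing τ with
  | zero => simp [missP, hl]
  | succ n ih =>
    rw [missP]
    exact Finset.sum_eq_zero fun c _ => by rw [ih _ (habs τ c hl), mul_zero]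

lemma missP_antitone (hβ : IsEnvStrat act β) (habs : Absorbing lam) (τ : Hist Γ) :
    Antitone fun n => missP act α β lam n τ := by
  refine antitone_nat_of_succ_le fun n => ?_
  induction n generalizing τ with
  | zero =>
    by_cases hl : lam τ = true
    · rw [missP_zero_of_lam habs _ τ hl, missP_zero_of_lam habs _ τ hl]
    · refine (missP_le_one hβ _ _).trans ?_
      simp [missP, hl]
  | succ n ih =>
    rw [missP, missP]
    exact Finset.sum_le_sum fun c _ => mul_le_mul_of_nonneg_left (ih _) (stepW_nonneg _ _ _ _ _)

lemma missP_add (habs : Absorbing lam) (Good : Hist Γ → Prop)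
    (hG : ∀ τ c, Good τ → 0 < stepW act α β τ c → Good (τ ++ [c])) (m : ℕ) (B : ℝ)
    (hB : ∀ τ, Good τ → missP act α β lam m τ ≤ B) (n : ℕ) (τ : Hist Γ) (hτ : Good τ) :
    missP act α β lam (n + m) τ ≤ B * missP act α β lam n τ := by
  induction n generalizing τ with
  | zero =>
    rw [Nat.zero_add]
    by_cases hl : lam τ = true
    · rw [missP_zero_of_lam habs _ τ hl, missP_zero_of_lam habs _ τ hl, mul_zero]
    · simpa [missP, hl] using hB τ hτ
  | succ n ih =>
    rw [Nat.succ_add, missP, missP, Finset.mul_sum]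
    refine Finset.sum_le_sum fun c _ => ?_
    rcases (stepW_nonneg act α β τ c).eq_or_lt with h0 | h0
    · rw [← h0]; simp
    · calc _ ≤ stepW act α β τ c * (B * missP act α β lam n (τ ++ [c])) :=
            mul_le_mul_of_nonneg_left (ih _ (hG τ c hτ h0)) h0.le
        _ = _ := by ring

lemma missP_pow (habs : Absorbing lam) (Good : Hist Γ → Prop)
    (hβ : IsEnvStrat act β)
    (hG : ∀ τ c, Good τ → 0 < stepW act α β τ c → Good (τ ++ [c])) (m : ℕ) (B : ℝ) (hB0 : 0 ≤ B)
    (hB : ∀ τ, Good τ → missP act α β lam m τ ≤ B) (k : ℕ) (τ : Hist Γ) (hτ : Good τ) :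
    missP act α β lam (k * m) τ ≤ B ^ k := by
  induction k with
  | zero => simpa using missP_le_one hβ _ _
  | succ k ih =>
    rw [Nat.succ_mul, pow_succ']
    exact (missP_add habs Good hG m B hB _ τ hτ).trans (mul_le_mul_of_nonneg_left ih hB0)

lemma measure_miss {μ : Measure (Play Γ)} (hμ : IsPrMeasure act α β [] μ) (n : ℕ) (τ : Hist Γ) :
    μ ((ReachEvent lam)ᶜ ∩ Cyl τ) ≤ μ (Cyl τ) * ENNReal.ofReal (missP act α β lam n τ) := by
  induction n generalizing τ with
  | zero =>
    by_cases hl : lam τ = true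
    · have : (ReachEvent lam)ᶜ ∩ Cyl τ = ∅ := by
        rw [Set.eq_empty_iff_forall_notMem]
        rintro π ⟨h1, h2⟩
        rw [mem_Cyl_iff] at h2
        exact h1 ⟨τ.length, by rw [h2]; exact hl⟩
      simp [this]
    · simpa [missP, hl] using measure_mono Set.inter_subset_right
  | succ n ih =>
    have hsub : (ReachEvent lam)ᶜ ∩ Cyl τ ⊆ ⋃ c, (ReachEvent lam)ᶜ ∩ Cyl (τ ++ [c]) := by
      rintro π ⟨h1, h2⟩
      exact Set.mem_iUnion.2 ⟨π τ.length, h1, (mem_Cyl_concat _ _ _).2 ⟨h2, rfl⟩⟩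
    calc μ ((ReachEvent lam)ᶜ ∩ Cyl τ)
        ≤ ∑ c, μ ((ReachEvent lam)ᶜ ∩ Cyl (τ ++ [c])) :=
          (measure_mono hsub).trans (measure_iUnion_fintype_le _ _)
      _ ≤ ∑ c, μ (Cyl τ) * ENNReal.ofReal (stepW act α β τ c * missP act α β lam n (τ ++ [c])) := by
          refine Finset.sum_le_sum fun c _ => (ih _).trans_eq ?_
          rw [pr_cyl hμ, pr_cyl hμ, extProb_concat, List.nil_append,
            ENNReal.ofReal_mul (extProb_nonneg _ _ _ _ _),
            ENNReal.ofReal_mul (stepW_nonneg _ _ _ _ _), mul_assoc]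
      _ = _ := by
          rw [missP, ENNReal.ofReal_sum_of_nonneg, Finset.mul_sum]
          exact fun c _ => mul_nonneg (stepW_nonneg _ _ _ _ _) (missP_nonneg _ _)

/-- Uniform distribution on a nonempty finset. -/
noncomputable def unifD (s : Finset A) (hs : s.Nonempty) : PDist A where
  f a := if a ∈ s then (s.card : ℝ)⁻¹ else 0
  nonneg a := by split_ifs <;> positivity
  sum_one := by
    have : (s.card : ℝ) ≠ 0 := by exact_mod_cast hs.card_ne_zero
    simp [this]

/-- Uniform on `s` if nonempty, uniform on everything otherwise. -/
noncomputable def unifE [Nonempty A] (s : Finset A) : PDist A :=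
  if hs : s.Nonempty then unifD s hs else unifD Finset.univ Finset.univ_nonempty

lemma unifE_pos [Nonempty A] {s : Finset A} (hs : s.Nonempty) {a : A}
    (ha : 0 < (unifE s).f a) : a ∈ s := by
  by_contra hn
  simp [unifE, hs, unifD, hn] at ha

lemma unifE_ge [Nonempty A] {s : Finset A} {a : A} (ha : a ∈ s) :
    (Fintype.card A : ℝ)⁻¹ ≤ (unifE s).f a := by
  have hs : s.Nonempty := ⟨a, ha⟩
  simp only [unifE, hs, unifD, ha, if_true, dif_pos]
  apply inv_anti₀
  · exact_mod_cast hs.card_pos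
  · exact_mod_cast s.card_le_univ

lemma rate_mono {N M : ℕ} (hNM : N ≤ M) : 1 - 1 / ((N : ℝ) + 1) ≤ 1 - 1 / ((M : ℝ) + 1) := by
  have : (N : ℝ) ≤ M := by exact_mod_cast hNM
  gcongr

lemma backward [Nonempty A] [Fintype P] (act : Γ → A)
    (sim : Hist Γ → Hist Γ → Prop) (hsim : IsIndist act sim)
    (lam : Hist Γ → Bool) (hcons : InfoConsistent sim lam) (habs : Absorbing lam)
    (h : Hist Γ → P) (hh : IsRectMorphism sim lam h)
    (δP : P → Γ → P) (hδ : ∀ (τ : Hist Γ) (c : Γ), δP (h τ) c = h (τ ++ [c]))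
    (hY : Sum.inl (h ([] : Hist Γ)) ∈ Ystar sim h act δP lam) :
    ∃ α : Hist Γ → PDist A, IsPlayerStrat sim α ∧
      ∀ β : Hist Γ → A → PDist Γ, IsEnvStrat act β →
      ∀ μ : Measure (Play Γ), IsPrMeasure act α β [] μ → μ (ReachEvent lam) = 1 := by
  set Y := Ystar sim h act δP lam with hYdef
  have hfix : OrderHom.lfp (innerOp sim h act δP lam Y) = Y :=
    OrderHom.map_gfp (outerOp sim h act δP lam)
  have hfix2 : innerOp sim h act δP lam Y Y = Y := by
    have := OrderHom.map_lfp (innerOp sim h act δP lam Y)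
    rwa [hfix] at this
  have hYsub : ∀ s ∈ Y, s ∈ intr (approxS sim h) Y ∧ s ∈ Pre act δP Y ∪ targetS A lam h := by
    intro s hs
    rw [← hfix2] at hs
    exact hs
  have hrefl : ∀ s : P ⊕ P × A, approxS sim h s s := by
    have hr : ∀ p : P, approx sim h p p := by
      intro p
      obtain ⟨τ, rfl⟩ := hh.surj p
      exact ⟨τ, τ, hsim.equiv.refl τ, rfl, rfl⟩
    rintro (p | ⟨p, a⟩)
    · exact hr p
    · exact ⟨hr p, rfl⟩
  have hint : ∀ s, s ∈ intr (approxS sim h) Y → s ∈ Y := fun s hs => hs s (hrefl s)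
  let S : Hist Γ → Finset A := fun τ => Finset.univ.filter fun a => Sum.inr (h τ, a) ∈ Y
  have hSmem : ∀ τ a, a ∈ S τ ↔ Sum.inr (h τ, a) ∈ Y := fun τ a => by simp [S]
  have hSsim : ∀ τ τ', sim τ τ' → S τ ⊆ S τ' := by
    intro τ τ' hs a ha
    rw [hSmem] at ha ⊢
    exact (hYsub _ ha).1 (Sum.inr (h τ', a)) ⟨⟨τ', τ, hsim.equiv.symm hs, rfl, rfl⟩, rfl⟩
  -- target states belong to Y together with all their actions
  have htarget : ∀ τ a, lam τ = true → Sum.inr (h τ, a) ∈ Y := by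
    let T : Set (P ⊕ P × A) := {s | ∃ τ, lam τ = true ∧
      (s = Sum.inl (h τ) ∨ ∃ a, s = Sum.inr (h τ, a))}
    have hTint : T ⊆ intr (approxS sim h) T := by
      rintro s ⟨τ, hl, rfl | ⟨a, rfl⟩⟩ s' hs'
      · rcases s' with p | ⟨p, b⟩
        · obtain ⟨τ', h1, rfl⟩ := approx_lift hh hs'
          exact ⟨τ', (hcons _ _ h1).trans hl, Or.inl rfl⟩
        · exact hs'.elim
      · rcases s' with p | ⟨p, b⟩
        · exact hs'.elim
        · obtain ⟨h0, rfl⟩ := hs'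
          obtain ⟨τ', h1, rfl⟩ := approx_lift hh h0
          exact ⟨τ', (hcons _ _ h1).trans hl, Or.inr ⟨b, rfl⟩⟩
    have hX1 : ∀ τ, lam τ = true →
        Sum.inl (h τ) ∈ OrderHom.lfp (innerOp sim h act δP lam T) := by
      intro τ hl
      rw [← OrderHom.map_lfp]
      exact ⟨hTint ⟨τ, hl, Or.inl rfl⟩, Or.inr ⟨h τ, ⟨τ, rfl, hl⟩, rfl⟩⟩
    have hX2 : ∀ τ a, lam τ = true →
        Sum.inr (h τ, a) ∈ OrderHom.lfp (innerOp sim h act δP lam T) := by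
      intro τ a hl
      rw [← OrderHom.map_lfp]
      refine ⟨hTint ⟨τ, hl, Or.inr ⟨a, rfl⟩⟩, Or.inl fun c _ => ?_⟩
      rw [hδ]
      exact hX1 _ (habs τ c hl)
    have hpost : T ≤ outerOp sim h act δP lam T := by
      rintro s ⟨τ, hl, rfl | ⟨a, rfl⟩⟩
      · exact hX1 τ hl
      · exact hX2 τ a hl
    intro τ a hl
    exact OrderHom.le_gfp _ hpost ⟨τ, hl, Or.inr ⟨a, rfl⟩⟩
  have hSne : ∀ τ, Sum.inl (h τ) ∈ Y → (S τ).Nonempty := by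
    intro τ hτ
    rcases (hYsub _ hτ).2 with ⟨a, ha⟩ | ⟨p, ⟨τ', hp, hl⟩, he⟩
    · exact ⟨a, (hSmem _ _).2 ha⟩
    · obtain rfl : p = h τ := by simpa using he
      obtain ⟨a⟩ := ‹Nonempty A›
      exact ⟨a, (hSmem _ _).2 (htarget τ a (by rw [← hl]; exact (hh.refines _ _ hp).symm))⟩
  have hnext : ∀ τ a c, Sum.inr (h τ, a) ∈ Y → act c = a → Sum.inl (h (τ ++ [c])) ∈ Y := by
    intro τ a c hτ hc
    rcases (hYsub _ hτ).2 with h1 | ⟨p, _, he⟩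
    · rw [← hδ]; exact h1 c hc
    · simp at he
  let α : Hist Γ → PDist A := fun τ => unifE (S τ)
  refine ⟨α, ?_, ?_⟩
  · intro τ τ' hs
    have : S τ = S τ' := (hSsim _ _ hs).antisymm (hSsim _ _ (hsim.equiv.symm hs))
    simp only [α, this]
  intro β hβ μ hμ
  have hG : ∀ τ c, Sum.inl (h τ) ∈ Y → 0 < stepW act α β τ c → Sum.inl (h (τ ++ [c])) ∈ Y := by
    intro τ c hτ hw
    have h1 : 0 < (α τ).f (act c) := pos_of_mul_pos_left hw ((β τ (act c)).nonneg c)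
    have h2 := unifE_pos (hSne τ hτ) h1
    exact hnext τ _ c ((hSmem _ _).1 h2) rfl
  let f := missP act α β lam
  let Q : (P ⊕ P × A) → Prop := fun s => match s with
    | Sum.inl p => ∃ N : ℕ, ∀ τ, h τ = p → f N τ ≤ 1 - 1 / ((N : ℝ) + 1)
    | Sum.inr (p, a) => ∃ N : ℕ, ∀ τ c, h τ = p → act c = a →
        f N (τ ++ [c]) ≤ 1 - 1 / ((N : ℝ) + 1)
  have hlift : ∀ {N M : ℕ} {τ}, N ≤ M → f N τ ≤ 1 - 1 / ((N : ℝ) + 1) →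
      f M τ ≤ 1 - 1 / ((M : ℝ) + 1) := by
    intro N M τ hNM hN
    exact (missP_antitone hβ habs τ hNM).trans (hN.trans (rate_mono hNM))
  have hQ : ∀ s ∈ Y, Q s := by
    have hle : OrderHom.lfp (innerOp sim h act δP lam Y) ≤ {s | s ∈ Y ∧ Q s} := by
      apply OrderHom.lfp_le
      rintro s ⟨hs1, hs2⟩
      refine ⟨hint s hs1, ?_⟩
      rcases s with p | ⟨p, a⟩
      · rcases hs2 with ⟨a, haY, N, hN⟩ | ⟨p', ⟨τ', hp, hl⟩, he⟩
        · refine ⟨Fintype.card A * (N + 1), ?_⟩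
          rintro τ rfl
          have hK : 1 ≤ Fintype.card A := Fintype.card_pos
          have hα : (Fintype.card A : ℝ)⁻¹ ≤ (α τ).f a := unifE_ge ((hSmem _ _).2 haY)
          have hKr : (0 : ℝ) < Fintype.card A := by exact_mod_cast hK
          have h1 : f (N + 1) τ ≤ 1 - (α τ).f a * (1 / ((N : ℝ) + 1)) := by
            have e1 : f (N + 1) τ = ∑ b, (α τ).f b * ∑ c, (β τ b).f c * f N (τ ++ [c]) :=
              stepW_sum_mul α hβ τ _
            have e2 : ∑ b, (α τ).f b * ∑ c, (β τ b).f c * f N (τ ++ [c]) ≤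
                ∑ b, ((α τ).f b - if b = a then (α τ).f b * (1 / ((N : ℝ) + 1)) else 0) := by
              refine Finset.sum_le_sum fun b _ => ?_
              have hb : ∀ r : ℝ, (∀ c, act c = b → f N (τ ++ [c]) ≤ r) →
                  ∑ c, (β τ b).f c * f N (τ ++ [c]) ≤ r := by
                intro r hr
                calc _ ≤ ∑ c, (β τ b).f c * r := by
                      refine Finset.sum_le_sum fun c _ => ?_
                      rcases ((β τ b).nonneg c).eq_or_lt with h0 | h0
                      · rw [← h0]; simp
                      · exact mul_le_mul_of_nonneg_left (hr c (hβ τ b c h0)) h0.le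
                  _ = r := by rw [← Finset.sum_mul, (β τ b).sum_one, one_mul]
              split_ifs with hba
              · subst hba
                have := mul_le_mul_of_nonneg_left (hb _ fun c hc => hN τ c rfl hc)
                  ((α τ).nonneg b)
                linarith
              · have := mul_le_mul_of_nonneg_left
                  (hb 1 fun c _ => missP_le_one hβ N (τ ++ [c])) ((α τ).nonneg b)
                linarith
            rw [e1]
            refine e2.trans_eq ?_
            rw [Finset.sum_sub_distrib, (α τ).sum_one]
            simp
          have h2 : f (Fintype.card A * (N + 1)) τ ≤ f (N + 1) τ :=
            missP_antitone hβ habs τ (Nat.le_mul_of_pos_left _ hK)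
          refine h2.trans (h1.trans ?_)
          have h3 : (Fintype.card A : ℝ)⁻¹ * (1 / ((N : ℝ) + 1)) ≤
              (α τ).f a * (1 / ((N : ℝ) + 1)) :=
            mul_le_mul_of_nonneg_right hα (by positivity)
          have h4 : 1 / (((Fintype.card A * (N + 1) : ℕ) : ℝ) + 1) ≤
              (Fintype.card A : ℝ)⁻¹ * (1 / ((N : ℝ) + 1)) := by
            rw [← one_div, one_div_mul_one_div]
            apply one_div_le_one_div_of_le
            · positivity
            · push_cast; linarith
          linarith
        · obtain rfl : p' = p := by simpa using he
          refine ⟨0, fun τ hτ => ?_⟩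
          have : lam τ = true := by rw [← hl]; exact hh.refines _ _ (hτ.trans hp.symm)
          simp [f, missP, this]
      · rcases hs2 with h1 | ⟨p', _, he⟩
        · have h2 : ∀ c : Γ, ∃ N : ℕ, act c = a →
              ∀ τ, h τ = δP p c → f N τ ≤ 1 - 1 / ((N : ℝ) + 1) := by
            intro c
            by_cases hc : act c = a
            · obtain ⟨-, N, hN⟩ := h1 c hc
              exact ⟨N, fun _ => hN⟩
            · exact ⟨0, fun h' => absurd h' hc⟩
          choose N hN using h2
          refine ⟨Finset.univ.sup N, ?_⟩
          rintro τ c rfl hc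
          exact hlift (Finset.le_sup (Finset.mem_univ c)) (hN c hc _ (hδ τ c).symm)
        · simp at he
    intro s hs
    rw [← hfix] at hs
    exact (hle hs).2
  have hunif : ∃ N : ℕ, ∀ τ, Sum.inl (h τ) ∈ Y → f N τ ≤ 1 - 1 / ((N : ℝ) + 1) := by
    have h2 : ∀ p : P, ∃ N : ℕ, Sum.inl p ∈ Y →
        ∀ τ, h τ = p → f N τ ≤ 1 - 1 / ((N : ℝ) + 1) := by
      intro p
      by_cases hp : Sum.inl p ∈ Y
      · obtain ⟨N, hN⟩ := hQ _ hp
        exact ⟨N, fun _ => hN⟩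
      · exact ⟨0, fun h' => absurd h' hp⟩
    choose N hN using h2
    exact ⟨Finset.univ.sup N, fun τ hτ =>
      hlift (Finset.le_sup (Finset.mem_univ (h τ))) (hN _ hτ τ rfl)⟩
  obtain ⟨N, hN⟩ := hunif
  set B : ℝ := 1 - 1 / ((N : ℝ) + 1) with hB
  have hB1 : B < 1 := by
    have : 0 < 1 / ((N : ℝ) + 1) := by positivity
    linarith
  have hB0 : 0 ≤ B := (missP_nonneg _ _).trans (hN [] hY)
  have hμ1 := hμ.1
  have hzero : μ (ReachEvent lam)ᶜ = 0 := by
    have hb : ∀ k : ℕ, μ (ReachEvent lam)ᶜ ≤ ENNReal.ofReal (B ^ k) := by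
      intro k
      have h1 := measure_miss (lam := lam) hμ (k * N) []
      rw [Cyl_nil, Set.inter_univ, measure_univ, one_mul] at h1
      exact h1.trans (ENNReal.ofReal_le_ofReal
        (missP_pow habs (fun τ => Sum.inl (h τ) ∈ Y) hβ hG N B hB0 hN k [] hY))
    have hlim : Filter.Tendsto (fun k : ℕ => ENNReal.ofReal (B ^ k)) Filter.atTop
        (nhds (ENNReal.ofReal 0)) :=
      ENNReal.tendsto_ofReal (tendsto_pow_atTop_nhds_zero_of_lt_one hB0 hB1)
    rw [ENNReal.ofReal_zero] at hlim
    exact le_antisymm (ge_of_tendsto' hlim hb) zero_le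
  refine le_antisymm prob_le_one ?_
  calc (1 : ENNReal) = μ (ReachEvent lam ∪ (ReachEvent lam)ᶜ) := by
        rw [Set.union_compl_self, measure_univ]
    _ ≤ μ (ReachEvent lam) + μ (ReachEvent lam)ᶜ := measure_union_le _ _
    _ = μ (ReachEvent lam) := by rw [hzero, add_zero]

end Backward

end ASWin


/-- Corollary: there exists an almost-sure winning strategy from the empty
history if and only if h(ε) ∈ Y*. -/
theorem as_winning_iff_mem_Ystar {Γ A P : Type} [Fintype Γ] [Nonempty Γ] [Fintype A] [Nonempty A] [Fintype P]
    (act : Γ → A) (hact : Function.Surjective act)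
    (sim : Hist Γ → Hist Γ → Prop) (hsim : IsIndist act sim)
    (lam : Hist Γ → Bool) (hcons : InfoConsistent sim lam) (habs : Absorbing lam)
    (h : Hist Γ → P) (hh : IsRectMorphism sim lam h)
    (δP : P → Γ → P) (hδ : ∀ (τ : Hist Γ) (c : Γ), δP (h τ) c = h (τ ++ [c])) :
    (∃ α : Hist Γ → PDist A, IsPlayerStrat sim α ∧ ASWinFrom act sim lam α ([] : Hist Γ)) ↔
      Sum.inl (h ([] : Hist Γ)) ∈ Ystar sim h act δP lam := by
  have hnil : ∀ τ' : Hist Γ, τ' ∈ InfoSet sim [] → τ' = [] := by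
    intro τ' hτ'
    have := hsim.length_eq _ _ hτ'
    simpa using this
  constructor
  · rintro ⟨α, hα, hwin⟩
    exact ASWin.forward act hact sim hsim lam habs h hh δP hδ α hα
      (hwin [] (hsim.equiv.refl []))
  · intro hY
    obtain ⟨α, hα, hwin⟩ := ASWin.backward act sim hsim lam hcons habs h hh δP hδ hY
    refine ⟨α, hα, fun τ' hτ' => ?_⟩
    rw [hnil τ' hτ']
    exact hwin
end

section
/- There exist x1, x2, x3 ∈ [0,1] such that for all y1, y2 ∈ [0,1] there exist z1, z2, z3 ∈ [0,1] such that for all t1, t2, t3 ∈ [0,1], there is some c ∈ {1, 2, 3, 4, 5, 6} with P_c ≠ Q_c. (In particular x1 = 1/2, x2 = 1, x3 = 0 is such a witness.) This establishes that the regular game G of the paper does not reduce to its induced abstract game H under alternating probabilistic trace containment. -/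
/-- P_c: the probability of reaching the leaf of color c (c = 1,…,6) in the game G
under the player strategy encoded by x1,x2,x3 and environment strategy t1,t2,t3. -/
noncomputable def Pvec (x1 x2 x3 t1 t2 t3 : ℝ) : Fin 6 → ℝ :=
  ![t1 * x1,
    (1 - t1) * x1,
    t1 * (1 - x1) * t2 * x2 + (1 - t1) * (1 - x1) * t3 * x3,
    t1 * (1 - x1) * t2 * (1 - x2) + (1 - t1) * (1 - x1) * t3 * (1 - x3),
    t1 * (1 - x1) * (1 - t2) * x3 + (1 - t1) * (1 - x1) * (1 - t3) * x2,
    t1 * (1 - x1) * (1 - t2) * (1 - x3) + (1 - t1) * (1 - x1) * (1 - t3) * (1 - x2)]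

/-- Q_c: the probability of reaching the leaf of color c (c = 1,…,6) in the abstract
game H under the player strategy encoded by y1,y2 and environment strategy z1,z2,z3. -/
noncomputable def Qvec (y1 y2 z1 z2 z3 : ℝ) : Fin 6 → ℝ :=
  ![z1 * y1,
    (1 - z1) * y1,
    z1 * (1 - y1) * z2 * y2 + (1 - z1) * (1 - y1) * z3 * y2,
    z1 * (1 - y1) * z2 * (1 - y2) + (1 - z1) * (1 - y1) * z3 * (1 - y2),
    z1 * (1 - y1) * (1 - z2) * y2 + (1 - z1) * (1 - y1) * (1 - z3) * y2,
    z1 * (1 - y1) * (1 - z2) * (1 - y2) + (1 - z1) * (1 - y1) * (1 - z3) * (1 - y2)]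

/-- The inner ∀∃∀ property of the formula ψ, for a fixed player strategy x1,x2,x3. -/
def psiInner (x1 x2 x3 : ℝ) : Prop :=
  ∀ y1 ∈ Set.Icc (0 : ℝ) 1, ∀ y2 ∈ Set.Icc (0 : ℝ) 1,
    ∃ z1 ∈ Set.Icc (0 : ℝ) 1, ∃ z2 ∈ Set.Icc (0 : ℝ) 1, ∃ z3 ∈ Set.Icc (0 : ℝ) 1,
      ∀ t1 ∈ Set.Icc (0 : ℝ) 1, ∀ t2 ∈ Set.Icc (0 : ℝ) 1, ∀ t3 ∈ Set.Icc (0 : ℝ) 1,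
        ∃ c : Fin 6, Pvec x1 x2 x3 t1 t2 t3 c ≠ Qvec y1 y2 z1 z2 z3 c

/-- The formula ψ holds: the game G does not reduce to the abstract game H under
alternating probabilistic trace containment; in particular x1 = 1/2, x2 = 1, x3 = 0
is a witness. -/
theorem psi_holds :
    (∃ x1 ∈ Set.Icc (0 : ℝ) 1, ∃ x2 ∈ Set.Icc (0 : ℝ) 1, ∃ x3 ∈ Set.Icc (0 : ℝ) 1,
      psiInner x1 x2 x3) ∧ psiInner (1 / 2) 1 0 := by
  have key : psiInner (1 / 2) 1 0 := by
    intro y1 _ y2 _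
    have hz : ∃ z ∈ Set.Icc (0 : ℝ) 1, z ≠ y2 := by
      by_cases h : y2 = 0
      · exact ⟨1, by norm_num, by rw [h]; norm_num⟩
      · exact ⟨0, by norm_num, fun hh => h hh.symm⟩
    obtain ⟨z, hz, hne⟩ := hz
    refine ⟨z, hz, 1, by norm_num, 1, by norm_num, ?_⟩
    intro t1 _ t2 _ t3 _
    by_contra hcon
    push Not at hcon
    have h0 := hcon 0
    have h1 := hcon 1
    have h2 := hcon 2
    have h5 : t1 * (1 - 1 / 2) * (1 - t2) * (1 - 0)
        + (1 - t1) * (1 - 1 / 2) * (1 - t3) * (1 - 1)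
        = z * (1 - y1) * (1 - 1) * (1 - y2) + (1 - z) * (1 - y1) * (1 - 1) * (1 - y2) := hcon 5
    simp [Pvec, Qvec] at h0 h1 h2
    have hy : y1 = 1 / 2 := by linarith
    subst hy
    apply hne
    linarith
  exact ⟨⟨1 / 2, by norm_num, 1, by norm_num, 0, by norm_num, key⟩, key⟩
end

section
/- There exist x1, x2, x3 ∈ [0,1] such that for all y1, y2 ∈ [0,1] there exist z1, z2, z3 ∈ [0,1] such that for all t1, t2, t3 ∈ [0,1], there is a subset T ⊆ {1, 2, 3, 4, 5, 6} for which the equivalence (Σ_{c∈T} P_c = 1 ⟺ Σ_{c∈T} Q_c = 1) fails. This shows that the counterexample game does not even preserve almost-sure probabilities of reachability objectives. -/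
/-- The formula ψ' holds: the counterexample game does not even preserve
almost-sure probabilities of reachability objectives. -/
theorem psi'_holds :
    ∃ x1 ∈ Set.Icc (0 : ℝ) 1, ∃ x2 ∈ Set.Icc (0 : ℝ) 1, ∃ x3 ∈ Set.Icc (0 : ℝ) 1,
      ∀ y1 ∈ Set.Icc (0 : ℝ) 1, ∀ y2 ∈ Set.Icc (0 : ℝ) 1,
        ∃ z1 ∈ Set.Icc (0 : ℝ) 1, ∃ z2 ∈ Set.Icc (0 : ℝ) 1, ∃ z3 ∈ Set.Icc (0 : ℝ) 1,
          ∀ t1 ∈ Set.Icc (0 : ℝ) 1, ∀ t2 ∈ Set.Icc (0 : ℝ) 1, ∀ t3 ∈ Set.Icc (0 : ℝ) 1,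
            ∃ T : Finset (Fin 6),
              ¬ ((∑ c ∈ T, Pvec x1 x2 x3 t1 t2 t3 c) = 1 ↔
                 (∑ c ∈ T, Qvec y1 y2 z1 z2 z3 c) = 1) := by
  refine ⟨1/2, by norm_num, 1, by norm_num, 0, by norm_num, ?_⟩
  intro y1 hy1 y2 hy2
  obtain ⟨z2, hz2, hz⟩ : ∃ z2 ∈ Set.Icc (0 : ℝ) 1, z2 * y2 + (1 - z2) * (1 - y2) ≠ 1 := by
    by_cases h : y2 = 1
    · exact ⟨0, by norm_num, by rw [h]; norm_num⟩
    · exact ⟨1, by norm_num, by simpa using h⟩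
  refine ⟨1, by norm_num, z2, hz2, 0, by norm_num, ?_⟩
  intro t1 ht1 t2 ht2 t3 ht3
  by_cases h1 : y1 = 1
  · refine ⟨{0, 1}, fun h => ?_⟩
    have := h.2 (by simp [Qvec, h1])
    simp [Pvec] at this
    linarith
  by_cases h2 : t1 = 1
  · refine ⟨{0, 2, 5}, fun h => ?_⟩
    have := h.1 (by simp [Pvec, h2]; ring)
    simp [Qvec] at this
    have h3 : (1 - y1) * (z2 * y2 + (1 - z2) * (1 - y2) - 1) = 0 := by linarith
    rcases mul_eq_zero.1 h3 with h4 | h4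
    · exact h1 (by linarith)
    · exact hz (by linarith)
  · refine ⟨{0, 2, 3, 4, 5}, fun h => ?_⟩
    have := h.2 (by simp [Qvec]; ring)
    simp [Pvec] at this
    exact h2 (by linarith)
end

section
/- Let ~ be an indistinguishability relation on Γ*, λ an information-consistent coloring, and h : Γ* → P a rectangular morphism. Then the relation ≈ = {(h(τ), h(τ')) | τ ~ τ'} is an equivalence relation on P, and for every history τ ∈ Γ*, the image under h of the information set of τ equals the ≈-equivalence class of h(τ): h([τ]~) = [h(τ)]≈. -/
open MeasureTheory
open scoped Classical

/-- Lemma (Berwanger–Doyen–Shukla): ≈ is an equivalence relation and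
h([τ]~) = [h(τ)]≈ for every history τ. -/
theorem approx_equivalence_and_image {Γ A P : Type} [Fintype Γ] [Nonempty Γ] [Fintype A] [Nonempty A] [Fintype P]
    (act : Γ → A) (hact : Function.Surjective act)
    (sim : Hist Γ → Hist Γ → Prop) (hsim : IsIndist act sim)
    (lam : Hist Γ → Bool) (hcons : InfoConsistent sim lam)
    (h : Hist Γ → P) (hh : IsRectMorphism sim lam h) :
    Equivalence (approx sim h) ∧
    ∀ τ : Hist Γ, h '' InfoSet sim τ = {p' : P | approx sim h p' (h τ)} := by
  have E := hsim.equiv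
  refine ⟨⟨?_, ?_, ?_⟩, ?_⟩
  · intro p
    obtain ⟨τ, rfl⟩ := hh.surj p
    exact ⟨τ, τ, E.refl τ, rfl, rfl⟩
  · rintro p q ⟨τ, τ', hs, h1, h2⟩
    exact ⟨τ', τ, E.symm hs, h2, h1⟩
  · rintro p q r ⟨τ₁, τ₂, h12, h1, h2⟩ ⟨τ₃, τ₄, h34, h3, h4⟩
    have hm : h τ₁ ∈ h '' InfoSet sim τ₂ := ⟨τ₁, h12, rfl⟩
    rw [hh.rect τ₂ τ₃ (h2.trans h3.symm)] at hm
    obtain ⟨σ, hσ, he⟩ := hm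
    exact ⟨σ, τ₄, E.trans hσ h34, he.trans h1, h4⟩
  · intro τ
    ext p
    constructor
    · rintro ⟨σ, hσ, rfl⟩
      exact ⟨σ, τ, hσ, rfl, rfl⟩
    · rintro ⟨τ₁, τ₂, h12, rfl, h2⟩
      rw [← hh.rect τ₂ τ h2]
      exact ⟨τ₁, h12, rfl⟩
end

section
/- Let ~ be an indistinguishability relation on Γ* and h : Γ* → P any surjective function, and let H = {(τ, τ') | h(τ) = h(τ')} be the kernel of h. Then h satisfies rectangularity (h(τ) = h(τ') implies h([τ]~) = h([τ']~)) if and only if H commutes with ~ under relational composition: for all histories τ, τ'', (there exists τ' with h(τ) = h(τ') and τ' ~ τ'') if and only if (there exists τ' with τ ~ τ' and h(τ') = h(τ'')). -/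
open MeasureTheory
open scoped Classical

/-- Rectangularity is equivalent to the kernel of h commuting with ~. -/
theorem rectangular_iff_kernel_commutes {Γ A P : Type}
    [Fintype Γ] [Nonempty Γ] [Fintype A] [Nonempty A] [Fintype P]
    (act : Γ → A) (hact : Function.Surjective act)
    (sim : Hist Γ → Hist Γ → Prop) (hsim : IsIndist act sim)
    (h : Hist Γ → P) (hsurj : Function.Surjective h) :
    (∀ τ τ' : Hist Γ, h τ = h τ' → h '' InfoSet sim τ = h '' InfoSet sim τ') ↔
      (∀ τ τ'' : Hist Γ,
        (∃ τ' : Hist Γ, h τ = h τ' ∧ sim τ' τ'') ↔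
        (∃ τ' : Hist Γ, sim τ τ' ∧ h τ' = h τ'')) := by
  constructor
  · intro hr τ τ''
    constructor
    · rintro ⟨τ', e, s⟩
      have hm : h τ'' ∈ h '' InfoSet sim τ' := ⟨τ'', hsim.equiv.symm s, rfl⟩
      rw [← hr τ τ' e] at hm
      obtain ⟨σ, hσ, e'⟩ := hm
      exact ⟨σ, hsim.equiv.symm hσ, e'⟩
    · rintro ⟨τ', s, e⟩
      have hm : h τ ∈ h '' InfoSet sim τ' := ⟨τ, s, rfl⟩
      rw [hr τ' τ'' e] at hm
      obtain ⟨σ, hσ, e'⟩ := hm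
      exact ⟨σ, e'.symm, hσ⟩
  · intro hc
    have key : ∀ τ τ' : Hist Γ, h τ = h τ' → h '' InfoSet sim τ ⊆ h '' InfoSet sim τ' := by
      rintro τ τ' e _ ⟨σ, hσ, rfl⟩
      obtain ⟨ρ, hρ, e'⟩ := (hc τ' σ).1 ⟨τ, e.symm, hsim.equiv.symm hσ⟩
      exact ⟨ρ, hsim.equiv.symm hρ, e'⟩
    intro τ τ' e
    exact Set.Subset.antisymm (key τ τ' e) (key τ' τ e.symm)
end
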